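/- arXiv:2203.04720 — 2 statements merged into one kernel-verified Lean document; each statement's English description precedes it below -/
import Mathlib

section
/- Let 1 ≤ q⃗ = (q_1,…,q_n) < ∞ (componentwise) and let φ : ℝ^n × (0,∞) → (0,∞) be a Lebesgue measurable function. Then the generalized mixed Morrey space M^φ_{q⃗}(ℝ^n), equipped with the norm ‖·‖_{M^φ_{q⃗}}, is a Banach space; in particular every Cauchy sequence in M^φ_{q⃗}(ℝ^n) converges in the norm ‖·‖_{M^φ_{q⃗}} to an element of M^φ_{q⃗}(ℝ^n). -/
open MeasureTheory ENNReal Set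

noncomputable section

/-- Euclidean distance on `Fin n → ℝ`. -/
def eudist (n : ℕ) (x y : Fin n → ℝ) : ℝ :=
  Real.sqrt (∑ i, (x i - y i) ^ 2)

/-- Open Euclidean ball in `Fin n → ℝ`. -/
def eball (n : ℕ) (x : Fin n → ℝ) (r : ℝ) : Set (Fin n → ℝ) :=
  {y | eudist n x y < r}

/-- Iterated mixed Lebesgue "norm" of an `ℝ≥0∞`-valued function: the innermost
integration is in the first coordinate with exponent `q 0`, the outermost in the
last coordinate with exponent `q (n-1)`. -/
def mixedLnorm : (n : ℕ) → (Fin n → ℝ) → ((Fin n → ℝ) → ℝ≥0∞) → ℝ≥0∞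
  | 0, _, g => g (fun i => i.elim0)
  | (n + 1), q, g =>
      (∫⁻ t : ℝ, (mixedLnorm n (fun i => q i.castSucc)
          (fun y => g (Fin.snoc y t))) ^ q (Fin.last n)) ^ (1 / q (Fin.last n))

/-- Mixed Lebesgue norm `‖f‖_{L^{q⃗}}` of a real-valued function on `ℝ^n`. -/
def mixedNorm (n : ℕ) (q : Fin n → ℝ) (f : (Fin n → ℝ) → ℝ) : ℝ≥0∞ :=
  mixedLnorm n q (fun x => ENNReal.ofReal |f x|)

/-- Generalized mixed Morrey norm of an `ℝ≥0∞`-valued function. -/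
def morreyLnorm (n : ℕ) (q : Fin n → ℝ) (φ : (Fin n → ℝ) → ℝ → ℝ)
    (g : (Fin n → ℝ) → ℝ≥0∞) : ℝ≥0∞ :=
  ⨆ (x : Fin n → ℝ) (r : ℝ) (_ : 0 < r),
    (ENNReal.ofReal (φ x r))⁻¹
      * (mixedNorm n q ((eball n x r).indicator fun _ => (1 : ℝ)))⁻¹
      * mixedLnorm n q ((eball n x r).indicator g)

/-- Generalized mixed Morrey norm `‖f‖_{M^φ_{q⃗}}` of a real-valued function. -/
def morreyNorm (n : ℕ) (q : Fin n → ℝ) (φ : (Fin n → ℝ) → ℝ → ℝ)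
    (f : (Fin n → ℝ) → ℝ) : ℝ≥0∞ :=
  morreyLnorm n q φ (fun x => ENNReal.ofReal |f x|)

/-- The BMO norm (as an extended real number). -/
def bmoNorm (n : ℕ) (b : (Fin n → ℝ) → ℝ) : ℝ≥0∞ :=
  ⨆ (x : Fin n → ℝ) (r : ℝ) (_ : 0 < r),
    ENNReal.ofReal ((volume (eball n x r)).toReal⁻¹
      * ∫ y in eball n x r, |b y - ⨍ z in eball n x r, b z|)

/-- Sublinearity in each entry of a multi-(sub)linear operator. -/
def EntrywiseSublinear (n m : ℕ)
    (T : (Fin m → ((Fin n → ℝ) → ℝ)) → ((Fin n → ℝ) → ℝ)) : Prop :=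
  (∀ (f : Fin m → ((Fin n → ℝ) → ℝ)) (i : Fin m) (g h : (Fin n → ℝ) → ℝ)
      (x : Fin n → ℝ),
      |T (Function.update f i (g + h)) x|
        ≤ |T (Function.update f i g) x| + |T (Function.update f i h) x|) ∧
  (∀ (f : Fin m → ((Fin n → ℝ) → ℝ)) (i : Fin m) (c : ℝ) (g : (Fin n → ℝ) → ℝ)
      (x : Fin n → ℝ),
      |T (Function.update f i (c • g)) x| = |c| * |T (Function.update f i g) x|)

/-- The multi-sublinear size condition (1.1) with constant `C`. -/
def SizeCond (n m : ℕ)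
    (T : (Fin m → ((Fin n → ℝ) → ℝ)) → ((Fin n → ℝ) → ℝ)) (C : ℝ) : Prop :=
  ∀ f : Fin m → ((Fin n → ℝ) → ℝ),
    (∀ i, Integrable (f i)) → (∀ i, HasCompactSupport (f i)) →
    ∀ x, x ∉ ⋂ j, Function.support (f j) →
      |T f x| ≤ C * ∫ y : Fin m → (Fin n → ℝ),
        (∏ i, |f i (y i)|) / Real.sqrt (∑ i, eudist n x (y i) ^ 2) ^ (m * n)

/-- The multi-sublinear commutator size condition (1.2), with symbol `b` and
distinguished index `i`, with constant `C`. -/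
def CommSizeCond (n m : ℕ) (b : (Fin n → ℝ) → ℝ) (i : Fin m)
    (T : (Fin m → ((Fin n → ℝ) → ℝ)) → ((Fin n → ℝ) → ℝ)) (C : ℝ) : Prop :=
  ∀ f : Fin m → ((Fin n → ℝ) → ℝ),
    (∀ k, Integrable (f k)) → (∀ k, HasCompactSupport (f k)) →
    ∀ x, x ∉ ⋂ j, Function.support (f j) →
      |T f x| ≤ C * ∫ y : Fin m → (Fin n → ℝ),
        |b x - b (y i)| * (∏ k, |f k (y k)|)
          / Real.sqrt (∑ k, eudist n x (y k) ^ 2) ^ (m * n)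

/-- The Hardy–Littlewood maximal operator. -/
def hlMax (n : ℕ) (f : (Fin n → ℝ) → ℝ) (x : Fin n → ℝ) : ℝ≥0∞ :=
  ⨆ (r : ℝ) (_ : 0 < r),
    (volume (eball n x r))⁻¹ * ∫⁻ y in eball n x r, ENNReal.ofReal |f y|

/-- The maximal commutator of the Hardy–Littlewood maximal operator. -/
def maxComm (n : ℕ) (b f : (Fin n → ℝ) → ℝ) (x : Fin n → ℝ) : ℝ≥0∞ :=
  ⨆ (r : ℝ) (_ : 0 < r),
    (volume (eball n x r))⁻¹
      * ∫⁻ y in eball n x r, ENNReal.ofReal (|b x - b y| * |f y|)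

/-- The multi-sublinear maximal operator `M_m`. -/
def multiMax (n m : ℕ) (f : Fin m → ((Fin n → ℝ) → ℝ)) (x : Fin n → ℝ) : ℝ≥0∞ :=
  ⨆ (r : ℝ) (_ : 0 < r),
    ∏ i, (volume (eball n x r))⁻¹ * ∫⁻ y in eball n x r, ENNReal.ofReal |f i y|

/-- The multi-sublinear maximal commutator `M^{b⃗}_{m,i}`. -/
def multiMaxComm (n m : ℕ) (b : Fin m → ((Fin n → ℝ) → ℝ)) (i : Fin m)
    (f : Fin m → ((Fin n → ℝ) → ℝ)) (x : Fin n → ℝ) : ℝ≥0∞ :=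
  (⨆ (r : ℝ) (_ : 0 < r),
      (volume (eball n x r))⁻¹
        * ∫⁻ y in eball n x r, ENNReal.ofReal (|b i x - b i y| * |f i y|)) *
  (⨆ (r : ℝ) (_ : 0 < r),
      ∏ k ∈ Finset.univ.erase i,
        (volume (eball n x r))⁻¹ * ∫⁻ y in eball n x r, ENNReal.ofReal |f k y|)

/-- `w` is an `A₁` weight with constant `c`. -/
def IsA1Weight (n : ℕ) (w : (Fin n → ℝ) → ℝ) (c : ℝ) : Prop :=
  (∀ x, 0 < w x) ∧ LocallyIntegrable w ∧
    ∀ (x : Fin n → ℝ) (r : ℝ), 0 < r →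
      ∀ᵐ y ∂(volume.restrict (eball n x r)),
        (volume (eball n x r)).toReal⁻¹ * ∫ z in eball n x r, w z ≤ c * w y

/-- `T` is an `m`-linear Calderón–Zygmund operator. -/
def IsCZOperator (n m : ℕ)
    (T : (Fin m → ((Fin n → ℝ) → ℝ)) → ((Fin n → ℝ) → ℝ)) : Prop :=
  -- additivity in each entry
  (∀ (f : Fin m → ((Fin n → ℝ) → ℝ)) (i : Fin m) (g h : (Fin n → ℝ) → ℝ),
      T (Function.update f i (g + h))
        = T (Function.update f i g) + T (Function.update f i h)) ∧
  -- homogeneity in each entry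
  (∀ (f : Fin m → ((Fin n → ℝ) → ℝ)) (i : Fin m) (c : ℝ) (g : (Fin n → ℝ) → ℝ),
      T (Function.update f i (c • g)) = c • T (Function.update f i g)) ∧
  -- boundedness from a product of Lebesgue spaces
  (∃ (s : Fin m → ℝ) (s₀ A : ℝ), (∀ i, 1 ≤ s i) ∧ 0 < s₀ ∧
      (1 / s₀ = ∑ i, 1 / s i) ∧ 0 < A ∧
      ∀ f : Fin m → ((Fin n → ℝ) → ℝ), (∀ i, Measurable (f i)) →
        (∀ i, mixedNorm n (fun _ => s i) (f i) ≠ ⊤) →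
        mixedNorm n (fun _ => s₀) (T f)
          ≤ ENNReal.ofReal A * ∏ i, mixedNorm n (fun _ => s i) (f i)) ∧
  -- Calderón–Zygmund kernel and representation
  (∃ (K : (Fin n → ℝ) → (Fin m → (Fin n → ℝ)) → ℝ) (ε C : ℝ), 0 < ε ∧ 0 < C ∧
      -- size estimate
      (∀ x y, ¬(∀ k, y k = x) →
        |K x y| ≤ C / (∑ k, eudist n x (y k)) ^ (m * n)) ∧
      -- regularity in the first variable
      (∀ x x' y, ¬(∀ k, y k = x) →
        2 * eudist n x x' ≤ (⨆ k, eudist n x (y k)) →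
        |K x y - K x' y|
          ≤ C * eudist n x x' ^ ε / (∑ k, eudist n x (y k)) ^ ((m * n : ℝ) + ε)) ∧
      -- regularity in each of the remaining variables
      (∀ x y (k : Fin m) (y' : Fin n → ℝ), ¬(∀ j, y j = x) →
        2 * eudist n (y k) y' ≤ (⨆ j, eudist n x (y j)) →
        |K x y - K x (Function.update y k y')|
          ≤ C * eudist n (y k) y' ^ ε / (∑ j, eudist n x (y j)) ^ ((m * n : ℝ) + ε)) ∧
      -- integral representation off the supports
      (∀ f : Fin m → ((Fin n → ℝ) → ℝ),
        (∀ j, Measurable (f j)) → (∀ j, ∃ M : ℝ, ∀ x, |f j x| ≤ M) →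
        (∀ j, HasCompactSupport (f j)) →
        ∀ x, x ∉ ⋂ j, Function.support (f j) →
          T f x = ∫ y : Fin m → (Fin n → ℝ), K x y * ∏ j, f j (y j)))

/-- The commutator `K^{b⃗}_{m,i}` of an `m`-linear operator. -/
def czComm (n m : ℕ) (T : (Fin m → ((Fin n → ℝ) → ℝ)) → ((Fin n → ℝ) → ℝ))
    (b : Fin m → ((Fin n → ℝ) → ℝ)) (i : Fin m)
    (f : Fin m → ((Fin n → ℝ) → ℝ)) : (Fin n → ℝ) → ℝ :=
  fun x => b i x * T f x - T (Function.update f i fun y => b i y * f i y) x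

lemma aux_snoc {α : Type} [MeasurableSpace α] {n : ℕ} :
    Measurable (fun p : (α × ℝ) × (Fin n → ℝ) => (p.1.1, (Fin.snoc p.2 p.1.2 : Fin (n+1) → ℝ))) := by
  refine (measurable_fst.comp measurable_fst).prodMk (measurable_pi_iff.2 fun i => ?_)
  refine Fin.lastCases ?_ (fun j => ?_) i
  · simp only [Fin.snoc_last]; fun_prop
  · simp only [Fin.snoc_castSucc]; fun_prop

lemma aux_meas (n : ℕ) : ∀ (q : Fin n → ℝ) {α : Type} [MeasurableSpace α]
    (g : α × (Fin n → ℝ) → ℝ≥0∞), Measurable g →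
    Measurable (fun a => mixedLnorm n q (fun y => g (a, y))) := by
  induction n with
  | zero =>
    intro q α _ g hg
    simp only [mixedLnorm]
    exact hg.comp (by fun_prop)
  | succ n ih =>
    intro q α _ g hg
    simp only [mixedLnorm]
    have h := ih (fun i => q i.castSucc) (α := α × ℝ) _ (hg.comp aux_snoc)
    exact (Measurable.lintegral_prod_right' (h.pow_const _)).pow_const _

lemma aux_meas_slice (n : ℕ) (q : Fin n → ℝ) (g : (Fin (n+1) → ℝ) → ℝ≥0∞) (hg : Measurable g) :
    Measurable (fun t : ℝ => mixedLnorm n q (fun y => g (Fin.snoc y t))) := by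
  have h := aux_meas n q (α := Unit × ℝ) _ ((hg.comp measurable_snd).comp aux_snoc)
  exact h.comp (g := fun a : Unit × ℝ => _) (f := fun t : ℝ => ((), t)) (by fun_prop)

lemma aux_slice (n : ℕ) (g : (Fin (n+1) → ℝ) → ℝ≥0∞) (hg : Measurable g) (t : ℝ) :
    Measurable (fun y : Fin n → ℝ => g (Fin.snoc y t)) := by
  have h : Measurable (fun y : Fin n → ℝ => (((), t), y)) := by fun_prop
  exact ((hg.comp measurable_snd).comp aux_snoc).comp h

lemma aux_mono (n : ℕ) : ∀ (q : Fin n → ℝ), (∀ j, 1 ≤ q j) → ∀ g h : (Fin n → ℝ) → ℝ≥0∞,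
    (∀ x, g x ≤ h x) → mixedLnorm n q g ≤ mixedLnorm n q h := by
  induction n with
  | zero => intro q _ g h hgh; exact hgh _
  | succ n ih =>
    intro q hq g h hgh
    have h0 : 0 ≤ q (Fin.last n) := zero_le_one.trans (hq _)
    simp only [mixedLnorm]
    refine ENNReal.rpow_le_rpow (lintegral_mono fun t => ENNReal.rpow_le_rpow ?_ h0) (by positivity)
    exact ih _ (fun j => hq _) _ _ fun y => hgh _

lemma aux_fin (p : ℝ) (hp : 1 ≤ p) (h : ℕ → ℝ → ℝ≥0∞) (hm : ∀ i, Measurable (h i)) (N : ℕ) :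
    (∫⁻ t, (∑ i ∈ Finset.range N, h i t) ^ p) ^ (1 / p)
      ≤ ∑ i ∈ Finset.range N, (∫⁻ t, (h i t) ^ p) ^ (1 / p) := by
  have hp0 : 0 < p := by linarith
  induction N with
  | zero => simp [hp0]
  | succ N ih =>
    simp only [Finset.sum_range_succ]
    have h1 : Measurable (fun t => ∑ i ∈ Finset.range N, h i t) :=
      Finset.measurable_fun_sum _ fun i _ => hm i
    exact (ENNReal.lintegral_Lp_add_le h1.aemeasurable (hm N).aemeasurable hp).trans (by gcongr)

lemma aux_inf (p : ℝ) (hp : 1 ≤ p) (h : ℕ → ℝ → ℝ≥0∞) (hm : ∀ i, Measurable (h i)) :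
    (∫⁻ t, (∑' i, h i t) ^ p) ^ (1 / p) ≤ ∑' i, (∫⁻ t, (h i t) ^ p) ^ (1 / p) := by
  have hp0 : 0 < p := by linarith
  have hp1 : 0 < 1 / p := by positivity
  have e1 : ∀ t, (∑' i, h i t) ^ p = ⨆ N, (∑ i ∈ Finset.range N, h i t) ^ p := fun t => by
    rw [ENNReal.tsum_eq_iSup_nat]
    exact (ENNReal.orderIsoRpow p hp0).map_iSup _
  simp_rw [e1]
  rw [lintegral_iSup]
  · have e2 := (ENNReal.orderIsoRpow (1/p) hp1).map_iSup
      (fun N => ∫⁻ t, (∑ i ∈ Finset.range N, h i t) ^ p)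
    simp only [ENNReal.orderIsoRpow_apply] at e2
    rw [e2]
    exact iSup_le fun N => (aux_fin p hp h hm N).trans (ENNReal.sum_le_tsum _)
  · exact fun N => (Finset.measurable_fun_sum _ fun i _ => hm i).pow_const _
  · intro a b hab t
    exact ENNReal.rpow_le_rpow
      (Finset.sum_le_sum_of_subset (Finset.range_mono hab)) hp0.le

lemma aux_tsum (n : ℕ) : ∀ (q : Fin n → ℝ), (∀ j, 1 ≤ q j) →
    ∀ g : ℕ → (Fin n → ℝ) → ℝ≥0∞, (∀ i, Measurable (g i)) →
    mixedLnorm n q (fun x => ∑' i, g i x) ≤ ∑' i, mixedLnorm n q (g i) := by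
  induction n with
  | zero => intro q _ g _; exact le_rfl
  | succ n ih =>
    intro q hq g hg
    have h0 : 0 ≤ q (Fin.last n) := zero_le_one.trans (hq _)
    simp only [mixedLnorm]
    refine le_trans ?_ (aux_inf _ (hq _) _ fun i => aux_meas_slice n _ (g i) (hg i))
    refine ENNReal.rpow_le_rpow (lintegral_mono fun t => ENNReal.rpow_le_rpow ?_ h0) (by positivity)
    exact ih _ (fun j => hq _) _ fun i => aux_slice n _ (hg i) t

lemma aux_ball (n : ℕ) (x : Fin n → ℝ) (r : ℝ) : MeasurableSet (eball n x r) := by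
  unfold eball eudist
  exact measurableSet_lt (by fun_prop) (by fun_prop)

lemma aux_morrey_mono (n : ℕ) (q : Fin n → ℝ) (hq : ∀ j, 1 ≤ q j) (φ : (Fin n → ℝ) → ℝ → ℝ)
    (g h : (Fin n → ℝ) → ℝ≥0∞) (hgh : ∀ x, g x ≤ h x) :
    morreyLnorm n q φ g ≤ morreyLnorm n q φ h := by
  unfold morreyLnorm
  refine iSup_mono fun x => iSup_mono fun r => iSup_mono fun hr => ?_
  gcongr
  exact aux_mono n q hq _ _ fun y => Set.indicator_le_indicator (hgh y)

lemma aux_morrey_tsum (n : ℕ) (q : Fin n → ℝ) (hq : ∀ j, 1 ≤ q j) (φ : (Fin n → ℝ) → ℝ → ℝ)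
    (g : ℕ → (Fin n → ℝ) → ℝ≥0∞) (hg : ∀ i, Measurable (g i)) :
    morreyLnorm n q φ (fun x => ∑' i, g i x) ≤ ∑' i, morreyLnorm n q φ (g i) := by
  rw [morreyLnorm]
  refine iSup_le fun x => iSup_le fun r => iSup_le fun hr => ?_
  have e : (eball n x r).indicator (fun x => ∑' i, g i x)
      = fun y => ∑' i, (eball n x r).indicator (g i) y := by
    funext y
    by_cases hy : y ∈ eball n x r <;> simp [hy]
  rw [e]
  refine (mul_le_mul_right (aux_tsum n q hq _ fun i => (hg i).indicator (aux_ball n x r)) _).trans ?_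
  rw [← ENNReal.tsum_mul_left]
  refine ENNReal.tsum_le_tsum fun i => ?_
  unfold morreyLnorm
  exact le_iSup_of_le x (le_iSup_of_le r (le_iSup_of_le hr le_rfl))

lemma aux_morrey_zero (n : ℕ) (q : Fin n → ℝ) (hq : ∀ j, 1 ≤ q j) (φ : (Fin n → ℝ) → ℝ → ℝ) :
    morreyLnorm n q φ (fun _ => 0) = 0 := by
  have h : ∀ n (q : Fin n → ℝ), (∀ j, 1 ≤ q j) → mixedLnorm n q (fun _ => 0) = 0 := by
    intro n
    induction n with
    | zero => intro q _; rfl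
    | succ n ih =>
      intro q hq
      have h0 : 0 < q (Fin.last n) := zero_lt_one.trans_le (hq _)
      simp only [mixedLnorm]
      rw [ih _ fun j => hq _]
      simp [h0]
  unfold morreyLnorm
  simp [Set.indicator_zero, h n q hq]

lemma aux_morrey_add (n : ℕ) (q : Fin n → ℝ) (hq : ∀ j, 1 ≤ q j) (φ : (Fin n → ℝ) → ℝ → ℝ)
    (g h : (Fin n → ℝ) → ℝ≥0∞) (hg : Measurable g) (hh : Measurable h) :
    morreyLnorm n q φ (fun x => g x + h x) ≤ morreyLnorm n q φ g + morreyLnorm n q φ h := by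
  let s : ℕ → (Fin n → ℝ) → ℝ≥0∞ := fun i => if i = 0 then g else if i = 1 then h else fun _ => 0
  have hs : ∀ i, Measurable (s i) := fun i => by
    simp only [s]; split_ifs <;> first | assumption | exact measurable_const
  have key := aux_morrey_tsum n q hq φ s hs
  have e1 : (fun x => ∑' i, s i x) = fun x => g x + h x := by
    funext x
    rw [tsum_eq_sum (s := Finset.range 2)]
    · simp [Finset.sum_range_succ, s]
    · intro i hi
      have : i ≠ 0 ∧ i ≠ 1 := by simp at hi; omega
      simp [s, this]
  have e2 : ∑' i, morreyLnorm n q φ (s i) = morreyLnorm n q φ g + morreyLnorm n q φ h := by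
    rw [tsum_eq_sum (s := Finset.range 2)]
    · simp [Finset.sum_range_succ, s]
    · intro i hi
      have : i ≠ 0 ∧ i ≠ 1 := by simp at hi; omega
      simp [s, this, aux_morrey_zero n q hq φ]
  rwa [e1, e2] at key

/-- the pointwise limit along a sequence, with the tail bound everywhere. -/
lemma aux_lim {X : Type} [MeasurableSpace X] (G : ℕ → X → ℝ) (hG : ∀ k, Measurable (G k)) :
    ∃ f : X → ℝ, Measurable f ∧ ∀ k x, ENNReal.ofReal |G k x - f x|
      ≤ ∑' i, ENNReal.ofReal |G (k + i + 1) x - G (k + i) x| := by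
  classical
  let S : X → ℝ≥0∞ := fun x => ∑' i, ENNReal.ofReal |G (i + 1) x - G i x|
  have hS : Measurable S := Measurable.ennreal_tsum fun i => by
    have := hG i; have := hG (i+1); fun_prop
  let A : Set X := {x | S x ≠ ⊤}
  have hA : MeasurableSet A := (hS (measurableSet_singleton ⊤)).compl
  have hed : ∀ a b : ℝ, ENNReal.ofReal |a - b| = edist a b := fun a b => by
    rw [edist_dist, Real.dist_eq]
  have hlim : ∀ x, ∃ l, Filter.Tendsto (fun k => A.indicator (G k) x) Filter.atTop (nhds l) := by
    intro x
    by_cases hx : x ∈ A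
    · simp only [Set.indicator_of_mem hx]
      refine cauchySeq_tendsto_of_complete ?_
      refine cauchySeq_of_edist_le_of_tsum_ne_top (fun i => ENNReal.ofReal |G (i + 1) x - G i x|)
        (fun i => ?_) hx
      rw [hed, edist_comm]
    · exact ⟨0, by simp [hx]⟩
  choose f hf using hlim
  refine ⟨f, measurable_of_tendsto_metrizable (fun k => (hG k).indicator hA)
    (tendsto_pi_nhds.2 hf), fun k x => ?_⟩
  by_cases hx : x ∈ A
  · have h := hf x
    simp only [Set.indicator_of_mem hx] at h
    rw [hed]
    have := edist_le_tsum_of_edist_le_of_tendsto (f := fun k => G k x)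
      (fun i => ENNReal.ofReal |G (i + 1) x - G i x|)
      (fun i => by rw [hed, edist_comm]) h k
    exact this
  · have hx' : S x = ⊤ := by simpa [A] using hx
    have h2 := Summable.sum_add_tsum_nat_add' (k := k)
      (f := fun i => ENNReal.ofReal |G (i + 1) x - G i x|) ENNReal.summable
    have h3 : ∑' i, ENNReal.ofReal |G (k + i + 1) x - G (k + i) x| = ⊤ := by
      have h4 : (∑ i ∈ Finset.range k, ENNReal.ofReal |G (i + 1) x - G i x|)
          + ∑' i, ENNReal.ofReal |G (i + k + 1) x - G (i + k) x| = ⊤ := h2.trans hx'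
      rcases ENNReal.add_eq_top.1 h4 with h5 | h5
      · exact absurd h5 (ENNReal.sum_ne_top.2 fun i _ => ENNReal.ofReal_ne_top)
      · simpa only [add_comm] using h5
    rw [h3]
    exact le_top

/-- the generalized mixed Morrey space is complete. -/
theorem stmt0 (n : ℕ) (hn : 0 < n) (q : Fin n → ℝ) (hq : ∀ j, 1 ≤ q j)
    (φ : (Fin n → ℝ) → ℝ → ℝ)
    (hφmeas : Measurable fun p : (Fin n → ℝ) × ℝ => φ p.1 p.2)
    (hφpos : ∀ x r, 0 < r → 0 < φ x r)
    (F : ℕ → (Fin n → ℝ) → ℝ)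
    (hFmeas : ∀ k, Measurable (F k))
    (hFfin : ∀ k, morreyNorm n q φ (F k) ≠ ⊤)
    (hcauchy : ∀ ε : ℝ, 0 < ε → ∃ N : ℕ, ∀ i j, N ≤ i → N ≤ j →
      morreyNorm n q φ (fun x => F i x - F j x) < ENNReal.ofReal ε) :
    ∃ f : (Fin n → ℝ) → ℝ, Measurable f ∧ morreyNorm n q φ f ≠ ⊤ ∧
      ∀ ε : ℝ, 0 < ε → ∃ N : ℕ, ∀ k, N ≤ k →
        morreyNorm n q φ (fun x => F k x - f x) < ENNReal.ofReal ε := by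
  have hstep : ∀ k : ℕ, ∃ N : ℕ, ∀ i j, N ≤ i → N ≤ j →
      morreyNorm n q φ (fun x => F i x - F j x) < ENNReal.ofReal ((1/2 : ℝ) ^ k) :=
    fun k => hcauchy _ (by positivity)
  choose M hM using hstep
  let K : ℕ → ℕ := fun k => ∑ i ∈ Finset.range (k + 1), M i
  have hKM : ∀ k, M k ≤ K k := fun k =>
    Finset.single_le_sum (f := M) (fun _ _ => Nat.zero_le _) (Finset.self_mem_range_succ k)
  have hKK : ∀ k, K k ≤ K (k + 1) := fun k => by
    simp only [K]; rw [Finset.sum_range_succ _ (k + 1)]; omega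
  obtain ⟨f, hfm, hf⟩ := aux_lim (fun k => F (K k)) (fun k => hFmeas _)
  have hmeas : ∀ u v : (Fin n → ℝ) → ℝ, Measurable u → Measurable v →
      Measurable (fun x => ENNReal.ofReal |u x - v x|) := fun u v hu hv => by fun_prop
  have hpow : ∀ k : ℕ, ENNReal.ofReal ((1/2 : ℝ) ^ k) = (2⁻¹ : ℝ≥0∞) ^ k := fun k => by
    rw [ENNReal.ofReal_pow (by norm_num), one_div, ENNReal.ofReal_inv_of_pos (by norm_num)]
    simp
  have htail : ∀ k, morreyNorm n q φ (fun x => F (K k) x - f x) ≤ 2 * (2⁻¹ : ℝ≥0∞) ^ k := by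
    intro k
    refine (aux_morrey_mono n q hq φ _ _ (hf k)).trans ?_
    refine (aux_morrey_tsum n q hq φ _ fun i => hmeas _ _ (hFmeas _) (hFmeas _)).trans ?_
    have : ∀ i, morreyLnorm n q φ
        (fun x => ENNReal.ofReal |F (K (k + i + 1)) x - F (K (k + i)) x|)
        ≤ (2⁻¹ : ℝ≥0∞) ^ k * (2⁻¹ : ℝ≥0∞) ^ i := fun i => by
      rw [← pow_add, ← hpow]
      exact (hM (k + i) _ _ ((hKM _).trans (hKK _)) (hKM _)).le
    refine (ENNReal.tsum_le_tsum this).trans ?_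
    rw [ENNReal.tsum_mul_left, ENNReal.tsum_geometric, ENNReal.one_sub_inv_two, inv_inv, mul_comm]
  have htri : ∀ u v w : (Fin n → ℝ) → ℝ, Measurable u → Measurable v → Measurable w →
      morreyNorm n q φ (fun x => u x - w x) ≤ morreyNorm n q φ (fun x => u x - v x)
        + morreyNorm n q φ (fun x => v x - w x) := fun u v w hu hv hw => by
    refine le_trans (aux_morrey_mono n q hq φ _ _ fun x => ?_)
      (aux_morrey_add n q hq φ _ _ (hmeas u v hu hv) (hmeas v w hv hw))
    rw [← ENNReal.ofReal_add (abs_nonneg _) (abs_nonneg _)]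
    exact ENNReal.ofReal_le_ofReal (abs_sub_le _ _ _)
  refine ⟨f, hfm, ?_, fun ε hε => ?_⟩
  · have h1 := htri (fun _ => 0) (F (K 0)) f measurable_const (hFmeas _) hfm
    have e1 : ∀ u : (Fin n → ℝ) → ℝ, morreyNorm n q φ (fun x => 0 - u x) = morreyNorm n q φ u :=
      fun u => by simp [morreyNorm]
    rw [e1, e1] at h1
    refine ne_top_of_le_ne_top (ENNReal.add_ne_top.2 ⟨hFfin _, ?_⟩) h1
    exact ne_top_of_le_ne_top (by simp) (htail 0)
  · obtain ⟨k, hk⟩ := exists_pow_lt_of_lt_one (show 0 < ε / 3 by positivity)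
      (show (1/2 : ℝ) < 1 by norm_num)
    refine ⟨M k, fun i hi => ?_⟩
    refine (htri (F i) (F (K k)) f (hFmeas _) (hFmeas _) hfm).trans_lt ?_
    have a := (hM k i (K k) hi (hKM k)).le
    have b := htail k
    refine (add_le_add a b).trans_lt ?_
    rw [← hpow, show (2 : ℝ≥0∞) = ENNReal.ofReal 2 by simp, ← ENNReal.ofReal_mul (by norm_num),
      ← ENNReal.ofReal_add (by positivity) (by positivity)]
    exact (ENNReal.ofReal_lt_ofReal_iff hε).2 (by linarith)
end
end

section
/- Let 1 < q⃗ = (q_1,…,q_n) < ∞ (componentwise). Then the Hardy–Littlewood maximal operator M is bounded on the mixed Lebesgue space L^{q⃗}(ℝ^n): there is a constant C > 0 such that ‖Mf‖_{L^{q⃗}} ≤ C ‖f‖_{L^{q⃗}} for all f ∈ L^{q⃗}(ℝ^n). -/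
open MeasureTheory ENNReal Set

noncomputable section

/-- Rational open intervals. -/
def qI (i : ℚ × ℚ) : Set ℝ := Ioo (i.1 : ℝ) (i.2 : ℝ)

lemma qI_meas (i : ℚ × ℚ) : MeasurableSet (qI i) := measurableSet_Ioo

/-- Uncentered maximal function over rational intervals for a measure. -/
def Mmax (μ : Measure ℝ) (f : ℝ → ℝ≥0∞) (x : ℝ) : ℝ≥0∞ :=
  ⨆ i : ℚ × ℚ, (qI i).indicator (fun _ => (μ (qI i))⁻¹ * ∫⁻ y in qI i, f y ∂μ) x

lemma Mmax_measurable (μ : Measure ℝ) (f : ℝ → ℝ≥0∞) : Measurable (Mmax μ f) := by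
  unfold Mmax
  exact Measurable.iSup fun i => measurable_const.indicator (qI_meas i)

lemma le_Mmax (μ : Measure ℝ) (f : ℝ → ℝ≥0∞) (i : ℚ × ℚ) {x : ℝ} (hx : x ∈ qI i) :
    (μ (qI i))⁻¹ * ∫⁻ y in qI i, f y ∂μ ≤ Mmax μ f x := by
  unfold Mmax
  refine le_trans ?_ (le_iSup _ i)
  simp [indicator_of_mem hx]

lemma Mmax_le {μ : Measure ℝ} {f : ℝ → ℝ≥0∞} {x : ℝ} {c : ℝ≥0∞}
    (h : ∀ i : ℚ × ℚ, x ∈ qI i → (μ (qI i))⁻¹ * ∫⁻ y in qI i, f y ∂μ ≤ c) :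
    Mmax μ f x ≤ c := by
  unfold Mmax
  refine iSup_le fun i => ?_
  by_cases hx : x ∈ qI i
  · simpa [indicator_of_mem hx] using h i hx
  · simp [indicator_of_notMem hx]

lemma overlap (S : Finset (ℚ × ℚ)) : ∃ S' ⊆ S, (⋃ i ∈ S', qI i) = (⋃ i ∈ S, qI i) ∧
    ∀ x, (Finset.card (S'.filter (fun i => (i.1 : ℝ) < x ∧ x < (i.2 : ℝ)))) ≤ 2 := by
  classical
  have hne : (S.powerset.filter (fun T => (⋃ i ∈ T, qI i) = (⋃ i ∈ S, qI i))).Nonempty :=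
    ⟨S, by simp⟩
  obtain ⟨S', hS'⟩ := Finset.exists_minimal hne
  have hmem := hS'.1
  simp only [Finset.mem_filter, Finset.mem_powerset] at hmem
  refine ⟨S', hmem.1, hmem.2, fun x => ?_⟩
  by_contra! hcard
  set T := S'.filter (fun i => (i.1 : ℝ) < x ∧ x < (i.2 : ℝ)) with hT
  have hTne : T.Nonempty := Finset.card_pos.1 (by omega)
  obtain ⟨α, hα, hαm⟩ := Finset.exists_min_image T (fun i => i.1) hTne
  obtain ⟨β, hβ, hβm⟩ := Finset.exists_max_image T (fun i => i.2) hTne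
  have : ∃ γ ∈ T, γ ∉ ({α, β} : Finset (ℚ × ℚ)) := by
    by_contra! hcon
    have h1 : T ⊆ ({α, β} : Finset (ℚ × ℚ)) := hcon
    have h2 := Finset.card_le_card h1
    have h3 : ({α, β} : Finset (ℚ × ℚ)).card ≤ 2 := Finset.card_le_two
    omega
  obtain ⟨γ, hγ, hγn⟩ := this
  simp only [Finset.mem_insert, Finset.mem_singleton, not_or] at hγn
  have hsub : qI γ ⊆ qI α ∪ qI β := by
    intro y hy
    have a1 : (α.1 : ℝ) ≤ γ.1 := by exact_mod_cast hαm γ hγ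
    have a2 : (γ.2 : ℝ) ≤ β.2 := by exact_mod_cast hβm γ hγ
    have hα' := (Finset.mem_filter.1 hα).2
    have hβ' := (Finset.mem_filter.1 hβ).2
    simp only [qI, mem_Ioo, mem_union] at hy ⊢
    by_cases hyx : y ≤ x
    · left; constructor <;> linarith
    · right; constructor <;> linarith
  have herase : S'.erase γ ∈ (S.powerset.filter (fun T => (⋃ i ∈ T, qI i) = (⋃ i ∈ S, qI i))) := by
    simp only [Finset.mem_filter, Finset.mem_powerset]
    refine ⟨(Finset.erase_subset _ _).trans hmem.1, ?_⟩
    rw [← hmem.2]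
    apply Subset.antisymm
    · exact biUnion_subset_biUnion_left (Finset.erase_subset _ _)
    · refine iUnion₂_subset fun i hi => ?_
      by_cases hig : i = γ
      · subst hig
        refine hsub.trans (union_subset ?_ ?_)
        · exact subset_biUnion_of_mem (u := qI)
            (Finset.mem_coe.2 (Finset.mem_erase.2 ⟨Ne.symm hγn.1, (Finset.mem_filter.1 hα).1⟩))
        · exact subset_biUnion_of_mem (u := qI)
            (Finset.mem_coe.2 (Finset.mem_erase.2 ⟨Ne.symm hγn.2, (Finset.mem_filter.1 hβ).1⟩))
      · exact subset_biUnion_of_mem (u := qI) (Finset.mem_coe.2 (Finset.mem_erase.2 ⟨hig, hi⟩))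
  have := hS'.2 herase (Finset.erase_subset _ _)
  exact absurd (this (Finset.mem_filter.1 hγ).1) (Finset.notMem_erase _ _)

lemma weak_finset (μ : Measure ℝ) (f : ℝ → ℝ≥0∞) (hf : Measurable f) (l : ℝ≥0∞)
    (S : Finset (ℚ × ℚ)) (hS : ∀ i ∈ S, l * μ (qI i) ≤ ∫⁻ y in qI i, f y ∂μ) :
    l * μ (⋃ i ∈ S, qI i) ≤ 2 * ∫⁻ y, f y ∂μ := by
  classical
  obtain ⟨S', hsub, hU, hcard⟩ := overlap S
  rw [← hU]
  calc l * μ (⋃ i ∈ S', qI i) ≤ l * ∑ i ∈ S', μ (qI i) := by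
        gcongr; exact measure_biUnion_finset_le _ _
    _ = ∑ i ∈ S', l * μ (qI i) := Finset.mul_sum _ _ _
    _ ≤ ∑ i ∈ S', ∫⁻ y in qI i, f y ∂μ := Finset.sum_le_sum fun i hi => hS i (hsub hi)
    _ = ∑ i ∈ S', ∫⁻ y, (qI i).indicator f y ∂μ := by
        refine Finset.sum_congr rfl fun i _ => ?_
        rw [lintegral_indicator (qI_meas i)]
    _ = ∫⁻ y, ∑ i ∈ S', (qI i).indicator f y ∂μ := by
        rw [lintegral_finsetSum]
        exact fun i _ => hf.indicator (qI_meas i)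
    _ ≤ ∫⁻ y, 2 * f y ∂μ := by
        refine lintegral_mono fun y => ?_
        have : ∑ i ∈ S', (qI i).indicator f y =
            ∑ i ∈ S'.filter (fun i => (i.1 : ℝ) < y ∧ y < (i.2 : ℝ)), f y := by
          rw [Finset.sum_filter]
          refine Finset.sum_congr rfl fun i _ => ?_
          simp [indicator, qI]
        rw [this, Finset.sum_const, nsmul_eq_mul]
        gcongr
        exact_mod_cast hcard y
    _ = 2 * ∫⁻ y, f y ∂μ := lintegral_const_mul _ hf

lemma weak_type (μ : Measure ℝ) (f : ℝ → ℝ≥0∞) (hf : Measurable f) (l : ℝ≥0∞) (hl : l ≠ ⊤) :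
    l * μ {x | 2 * l < Mmax μ f x} ≤ 2 * ∫⁻ y, {y | l < f y}.indicator f y ∂μ := by
  classical
  set g := {y | l < f y}.indicator f with hg
  have hgm : Measurable g := hf.indicator (measurableSet_lt measurable_const hf)
  let A : Set (ℚ × ℚ) := {i | l * μ (qI i) ≤ ∫⁻ y in qI i, g y ∂μ}
  have hfg : ∀ y, f y ≤ g y + l := by
    intro y
    by_cases h : l < f y
    · simp [hg, indicator_of_mem (show y ∈ {y | l < f y} from h)]
    · exact (not_lt.1 h).trans le_add_self
  have hsub : {x | 2 * l < Mmax μ f x} ⊆ ⋃ i : ℚ × ℚ, if i ∈ A then qI i else ∅ := by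
    intro x hx
    simp only [mem_ofPred_eq, Mmax, lt_iSup_iff] at hx
    obtain ⟨i, hi⟩ := hx
    have hxi : x ∈ qI i := by
      by_contra h
      simp [indicator_of_notMem h] at hi
    rw [indicator_of_mem hxi] at hi
    have htop : μ (qI i) ≠ ⊤ := by
      intro h
      simp [h] at hi
    have h1 : 2 * l * μ (qI i) ≤ ∫⁻ y in qI i, f y ∂μ := by
      by_cases h0 : μ (qI i) = 0
      · simp [h0]
      · calc 2 * l * μ (qI i) ≤ ((μ (qI i))⁻¹ * ∫⁻ y in qI i, f y ∂μ) * μ (qI i) := by gcongr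
          _ = ((μ (qI i))⁻¹ * μ (qI i)) * ∫⁻ y in qI i, f y ∂μ := by ring
          _ = _ := by rw [ENNReal.inv_mul_cancel h0 htop, one_mul]
    have h2 : ∫⁻ y in qI i, f y ∂μ ≤ ∫⁻ y in qI i, g y ∂μ + l * μ (qI i) := by
      calc _ ≤ ∫⁻ y in qI i, (g y + l) ∂μ := lintegral_mono hfg
        _ = _ := by rw [lintegral_add_right _ measurable_const]; simp
    have hA : i ∈ A := by
      have h3 : l * μ (qI i) + l * μ (qI i) ≤ ∫⁻ y in qI i, g y ∂μ + l * μ (qI i) := by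
        refine le_trans (le_of_eq (by ring)) (h1.trans h2)
      exact (ENNReal.add_le_add_iff_right (ENNReal.mul_ne_top hl htop)).1 h3
    exact mem_iUnion.2 ⟨i, by simpa [hA] using hxi⟩
  have hU : (⋃ i : ℚ × ℚ, if i ∈ A then qI i else ∅) =
      ⋃ S : Finset (ℚ × ℚ), ⋃ i ∈ S.filter (· ∈ A), qI i := by
    ext x
    simp only [mem_iUnion, Finset.mem_filter]
    constructor
    · rintro ⟨i, hi⟩
      by_cases hA : i ∈ A
      · exact ⟨{i}, i, ⟨by simp, hA⟩, by simpa [hA] using hi⟩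
      · simp [hA] at hi
    · rintro ⟨S, i, ⟨_, hA⟩, hi⟩
      exact ⟨i, by simpa [hA] using hi⟩
  have hdir : Directed (fun x1 x2 => x1 ⊆ x2)
      (fun S : Finset (ℚ × ℚ) => ⋃ i ∈ S.filter (· ∈ A), qI i) := by
    apply Monotone.directed_le
    intro S T hST
    exact biUnion_subset_biUnion_left (Finset.filter_subset_filter _ hST)
  calc l * μ {x | 2 * l < Mmax μ f x} ≤ l * μ (⋃ i : ℚ × ℚ, if i ∈ A then qI i else ∅) := by
        gcongr
    _ = ⨆ S : Finset (ℚ × ℚ), l * μ (⋃ i ∈ S.filter (· ∈ A), qI i) := by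
        rw [hU, hdir.measure_iUnion, ENNReal.mul_iSup]
    _ ≤ _ := iSup_le fun S => weak_finset μ g hgm l _ fun i hi => (Finset.mem_filter.1 hi).2

lemma layer (a : ℝ≥0∞) (r : ℝ) (hr : 0 < r) :
    a ^ r = ENNReal.ofReal r * ∫⁻ t in Ioi (0:ℝ),
      {t : ℝ | ENNReal.ofReal t < a}.indicator (fun t => ENNReal.ofReal (t ^ (r - 1))) t := by
  have key : ∀ b : ℝ, 0 ≤ b → (ENNReal.ofReal b) ^ r = ENNReal.ofReal r * ∫⁻ t in Ioi (0:ℝ),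
      {t : ℝ | t < b}.indicator (fun t => ENNReal.ofReal (t ^ (r - 1))) t := by
    intro b hb
    have := lintegral_rpow_eq_lintegral_meas_lt_mul (Measure.dirac (0:ℝ)) (f := fun _ => b)
      (Filter.Eventually.of_forall fun _ => hb) aemeasurable_const hr
    simp only [lintegral_const, measure_univ, mul_one] at this
    rw [ENNReal.ofReal_rpow_of_nonneg hb hr.le, this]
    congr 1
    refine lintegral_congr fun t => ?_
    by_cases h : t < b <;> simp [h, indicator]
  by_cases ha : a = ⊤
  · subst ha
    rw [ENNReal.top_rpow_of_pos hr]
    symm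
    rw [eq_top_iff]
    refine ENNReal.le_of_forall_nnreal_lt fun c _ => ?_
    have h := key ((c:ℝ) ^ (1/r)) (by positivity)
    have h2 : (c : ℝ≥0∞) = (ENNReal.ofReal ((c:ℝ) ^ (1/r))) ^ r := by
      rw [ENNReal.ofReal_rpow_of_nonneg (by positivity) hr.le, ← Real.rpow_mul (by positivity),
        one_div_mul_cancel hr.ne', Real.rpow_one, ENNReal.ofReal_coe_nnreal]
    rw [h2, h]
    gcongr
    exact fun _ => ENNReal.ofReal_lt_top
  · have h := key a.toReal toReal_nonneg
    rw [ENNReal.ofReal_toReal ha] at h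
    rw [h]
    congr 1
    refine setLIntegral_congr_fun measurableSet_Ioi fun t ht => ?_
    have : ENNReal.ofReal t < a ↔ t < a.toReal := ENNReal.ofReal_lt_iff_lt_toReal (le_of_lt ht) ha
    simp [indicator, this]

lemma strong_type (p : ℝ) (hp : 1 < p) : ∃ C : ℝ≥0∞, C ≠ ⊤ ∧ ∀ (μ : Measure ℝ) [SFinite μ]
    (f : ℝ → ℝ≥0∞), Measurable f → ∫⁻ x, (Mmax μ f x) ^ p ∂μ ≤ C * ∫⁻ x, f x ^ p ∂μ := by
  refine ⟨2 ^ p * (ENNReal.ofReal p * (2 * (ENNReal.ofReal (p-1))⁻¹)), ?_, ?_⟩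
  · have : ENNReal.ofReal (p-1) ≠ 0 := by simp; linarith
    finiteness
  intro μ _ f hf
  have hM := Mmax_measurable μ f
  have hm1 : Measurable (fun z : ℝ × ℝ => {t : ℝ | ENNReal.ofReal t < Mmax μ f z.1 / 2}.indicator
      (fun t => ENNReal.ofReal (t ^ (p - 1))) z.2) := by
    have : (fun z : ℝ × ℝ => {t : ℝ | ENNReal.ofReal t < Mmax μ f z.1 / 2}.indicator
      (fun t => ENNReal.ofReal (t ^ (p - 1))) z.2) =
      {z : ℝ × ℝ | ENNReal.ofReal z.2 < Mmax μ f z.1 / 2}.indicator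
        (fun z => ENNReal.ofReal (z.2 ^ (p - 1))) := by
      ext z; simp [indicator]
    rw [this]
    refine Measurable.indicator (by fun_prop) (measurableSet_lt (by fun_prop) ?_)
    exact (hM.comp measurable_fst).div_const 2
  have hm2 : Measurable (fun z : ℝ × ℝ => f z.2 * {t : ℝ | ENNReal.ofReal t < f z.2}.indicator
      (fun t => ENNReal.ofReal (t ^ (p - 1 - 1))) z.1) := by
    have : (fun z : ℝ × ℝ => {t : ℝ | ENNReal.ofReal t < f z.2}.indicator
      (fun t => ENNReal.ofReal (t ^ (p - 1 - 1))) z.1) =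
      {z : ℝ × ℝ | ENNReal.ofReal z.1 < f z.2}.indicator
        (fun z => ENNReal.ofReal (z.1 ^ (p - 1 - 1))) := by
      ext z; simp [indicator]
    refine (hf.comp measurable_snd).mul ?_
    rw [this]
    exact Measurable.indicator (by fun_prop)
      (measurableSet_lt (by fun_prop) (hf.comp measurable_snd))
  have h2 : ∀ x, (Mmax μ f x) ^ p = 2 ^ p * (Mmax μ f x / 2) ^ p := by
    intro x
    rw [← ENNReal.mul_rpow_of_nonneg _ _ (by linarith : (0:ℝ) ≤ p),
      ENNReal.mul_div_cancel (by norm_num) (by norm_num)]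
  calc ∫⁻ x, (Mmax μ f x) ^ p ∂μ = 2 ^ p * ∫⁻ x, (Mmax μ f x / 2) ^ p ∂μ := by
        simp_rw [h2]
        rw [lintegral_const_mul]
        exact (hM.div_const 2).pow_const p
    _ = 2 ^ p * (ENNReal.ofReal p * ∫⁻ x, (∫⁻ t in Ioi (0:ℝ),
        {t : ℝ | ENNReal.ofReal t < Mmax μ f x / 2}.indicator
          (fun t => ENNReal.ofReal (t ^ (p - 1))) t) ∂μ) := by
        congr 1
        rw [← lintegral_const_mul]
        · exact lintegral_congr fun x => layer _ p (by linarith)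
        · exact hm1.lintegral_prod_right'
    _ = 2 ^ p * (ENNReal.ofReal p * ∫⁻ t in Ioi (0:ℝ), ∫⁻ x,
        {t : ℝ | ENNReal.ofReal t < Mmax μ f x / 2}.indicator
          (fun t => ENNReal.ofReal (t ^ (p - 1))) t ∂μ) := by
        rw [lintegral_lintegral_swap]
        exact hm1.aemeasurable
    _ ≤ 2 ^ p * (ENNReal.ofReal p * ∫⁻ t in Ioi (0:ℝ), 2 * ∫⁻ x,
        f x * {t : ℝ | ENNReal.ofReal t < f x}.indicator
          (fun t => ENNReal.ofReal (t ^ (p - 1 - 1))) t ∂μ) := by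
        gcongr 2 ^ p * (ENNReal.ofReal p * ?_)
        refine setLIntegral_mono' measurableSet_Ioi fun t ht => ?_
        have ht' : (0:ℝ) < t := ht
        have e1 : ∫⁻ x, {t : ℝ | ENNReal.ofReal t < Mmax μ f x / 2}.indicator
          (fun t => ENNReal.ofReal (t ^ (p - 1))) t ∂μ = ENNReal.ofReal (t ^ (p-1)) *
            μ {x | 2 * ENNReal.ofReal t < Mmax μ f x} := by
          rw [← lintegral_indicator_const]
          · refine lintegral_congr fun x => ?_
            have : ENNReal.ofReal t < Mmax μ f x / 2 ↔ 2 * ENNReal.ofReal t < Mmax μ f x := by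
              rw [ENNReal.lt_div_iff_mul_lt (by simp) (by simp), mul_comm]
            simp [indicator, this]
          · exact measurableSet_lt measurable_const hM
        have e2 : ∫⁻ x, f x * {t : ℝ | ENNReal.ofReal t < f x}.indicator
          (fun t => ENNReal.ofReal (t ^ (p - 1 - 1))) t ∂μ = ENNReal.ofReal (t ^ (p - 1 - 1)) *
            ∫⁻ y, {y | ENNReal.ofReal t < f y}.indicator f y ∂μ := by
          rw [← lintegral_const_mul]
          · refine lintegral_congr fun x => ?_
            by_cases h : ENNReal.ofReal t < f x <;> simp [indicator, h, mul_comm]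
          · exact hf.indicator (measurableSet_lt measurable_const hf)
        rw [e1, e2]
        have e3 : ENNReal.ofReal (t ^ (p-1)) = ENNReal.ofReal (t ^ (p-1-1)) * ENNReal.ofReal t := by
          rw [← ENNReal.ofReal_mul (by positivity)]
          congr 1
          rw [Real.rpow_sub_one ht'.ne' (p-1)]
          field_simp
        rw [e3, mul_assoc]
        calc _ ≤ ENNReal.ofReal (t ^ (p-1-1)) * (2 * ∫⁻ y, {y | ENNReal.ofReal t < f y}.indicator f y ∂μ) := by
              exact mul_le_mul_right (weak_type μ f hf _ ENNReal.ofReal_ne_top) _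
          _ = _ := by ring
    _ = 2 ^ p * (ENNReal.ofReal p * (2 * ∫⁻ x, f x * (∫⁻ t in Ioi (0:ℝ),
        {t : ℝ | ENNReal.ofReal t < f x}.indicator
          (fun t => ENNReal.ofReal (t ^ (p - 1 - 1))) t) ∂μ)) := by
        congr 2
        rw [lintegral_const_mul _ hm2.lintegral_prod_right']
        congr 1
        rw [lintegral_lintegral_swap hm2.aemeasurable]
        refine lintegral_congr fun x => ?_
        dsimp only
        rw [lintegral_const_mul]
        exact Measurable.indicator (by fun_prop) (measurableSet_lt (by fun_prop) measurable_const)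
    _ = 2 ^ p * (ENNReal.ofReal p * (2 * ∫⁻ x, (ENNReal.ofReal (p-1))⁻¹ * f x ^ p ∂μ)) := by
        congr 3
        refine lintegral_congr fun x => ?_
        have hl := layer (f x) (p-1) (by linarith)
        have h0 : ENNReal.ofReal (p-1) ≠ 0 := by simp; linarith
        have : ∫⁻ t in Ioi (0:ℝ), {t : ℝ | ENNReal.ofReal t < f x}.indicator
          (fun t => ENNReal.ofReal (t ^ (p - 1 - 1))) t = (ENNReal.ofReal (p-1))⁻¹ * f x ^ (p-1) := by
          rw [hl, ← mul_assoc, ENNReal.inv_mul_cancel h0 (by simp), one_mul]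
        rw [this, mul_left_comm]
        congr 1
        have : f x * f x ^ (p-1) = f x ^ (1:ℝ) * f x ^ (p-1) := by rw [ENNReal.rpow_one]
        rw [this, ← ENNReal.rpow_add_of_nonneg _ _ (by norm_num) (by linarith)]
        congr 1; ring
    _ = _ := by
        rw [lintegral_const_mul _ (hf.pow_const p)]
        ring

/-- Exponential parametrization of positive finite extended reals. -/
def EE (a : ℝ) : ℝ≥0∞ := ENNReal.ofReal (Real.exp a)

lemma EE_mul (a b : ℝ) : EE a * EE b = EE (a + b) := by
  unfold EE
  rw [← ENNReal.ofReal_mul (Real.exp_pos a).le, Real.exp_add]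

lemma EE_rpow (a s : ℝ) : EE a ^ s = EE (a * s) := by
  unfold EE
  rw [ENNReal.ofReal_rpow_of_pos (Real.exp_pos a), Real.exp_mul]

lemma EE_inv (a : ℝ) : (EE a)⁻¹ = EE (-a) := by
  unfold EE
  rw [← ENNReal.ofReal_inv_of_pos (Real.exp_pos a), Real.exp_neg]

lemma EE_ex {x : ℝ≥0∞} (h0 : x ≠ 0) (ht : x ≠ ⊤) : ∃ a, x = EE a := by
  refine ⟨Real.log x.toReal, ?_⟩
  unfold EE
  rw [Real.exp_log (ENNReal.toReal_pos h0 ht), ENNReal.ofReal_toReal ht]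

lemma EE_ne_zero (a : ℝ) : EE a ≠ 0 := by
  unfold EE
  simpa using Real.exp_pos a

lemma EE_ne_top (a : ℝ) : EE a ≠ ⊤ := ENNReal.ofReal_ne_top

lemma EE_le {a b : ℝ} : EE a ≤ EE b ↔ a ≤ b := by
  unfold EE
  rw [ENNReal.ofReal_le_ofReal_iff (Real.exp_pos b).le, Real.exp_le_exp]

/-- `A₁` weights on the line. -/
structure A1 (K : ℝ≥0∞) (u : ℝ → ℝ≥0∞) : Prop where
  meas : Measurable u
  pos : ∀ᵐ x, u x ≠ 0
  fin : ∀ᵐ x, u x ≠ ⊤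
  le : ∀ᵐ x, Mmax volume u x ≤ K * u x

/-- The factored weights. -/
def wt (p : ℝ) (u v : ℝ → ℝ≥0∞) (x : ℝ) : ℝ≥0∞ := u x * v x ^ (1 - p)

lemma wt_meas {p : ℝ} {u v : ℝ → ℝ≥0∞} (hu : Measurable u) (hv : Measurable v) :
    Measurable (wt p u v) := hu.mul (hv.pow_const _)

lemma wt_pos {p : ℝ} {u v : ℝ → ℝ≥0∞} {K : ℝ≥0∞} (hu : A1 K u) (hv : A1 K v) :
    ∀ᵐ x, wt p u v x ≠ 0 ∧ wt p u v x ≠ ⊤ := by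
  filter_upwards [hu.pos, hu.fin, hv.pos, hv.fin] with x h1 h2 h3 h4
  obtain ⟨a, ha⟩ := EE_ex h1 h2
  obtain ⟨b, hb⟩ := EE_ex h3 h4
  unfold wt
  rw [ha, hb, EE_rpow, EE_mul]
  exact ⟨EE_ne_zero _, EE_ne_top _⟩

lemma vol_qI_ne_top (i : ℚ × ℚ) : volume (qI i) ≠ ⊤ := by simp [qI]

lemma int_pos {u : ℝ → ℝ≥0∞} (hm : Measurable u) (h : ∀ᵐ x, u x ≠ 0) {s : Set ℝ}
    (hs : volume s ≠ 0) : ∫⁻ x in s, u x ≠ 0 := by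
  intro h0
  rw [lintegral_eq_zero_iff hm] at h0
  have h1 : ∀ᵐ x ∂(volume.restrict s), False := by
    filter_upwards [h0, ae_restrict_of_ae h] with x a b using b a
  rw [Filter.eventually_false_iff_eq_bot, ae_eq_bot, Measure.restrict_eq_zero] at h1
  exact hs h1

lemma A1.avg {K : ℝ≥0∞} {u : ℝ → ℝ≥0∞} (hu : A1 K u) (i : ℚ × ℚ) :
    ∀ᵐ x ∂(volume.restrict (qI i)), (volume (qI i))⁻¹ * ∫⁻ y in qI i, u y ≤ K * u x := by
  filter_upwards [ae_restrict_of_ae hu.le, ae_restrict_mem (qI_meas i)] with x h1 h2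
  exact (le_Mmax _ _ i h2).trans h1

lemma A1.int_ne_top {K : ℝ≥0∞} (hK : K ≠ ⊤) {u : ℝ → ℝ≥0∞} (hu : A1 K u) (i : ℚ × ℚ)
    (h0 : volume (qI i) ≠ 0) : ∫⁻ y in qI i, u y ≠ ⊤ := by
  have h1 : ∀ᵐ x ∂(volume.restrict (qI i)), (volume (qI i))⁻¹ * ∫⁻ y in qI i, u y ≠ ⊤ := by
    filter_upwards [hu.avg i, ae_restrict_of_ae hu.fin] with x a b
    exact ne_top_of_le_ne_top (ENNReal.mul_ne_top hK b) a
  have : (ae (volume.restrict (qI i))).NeBot := by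
    rw [ae_neBot]
    simpa using h0
  obtain ⟨x, hx⟩ := h1.exists
  intro h
  rw [h] at hx
  exact hx (ENNReal.mul_top (ENNReal.inv_ne_zero.2 (vol_qI_ne_top i)))

lemma wt_int {K : ℝ≥0∞} (hK0 : K ≠ 0) (hK : K ≠ ⊤) {u v : ℝ → ℝ≥0∞} (hu : A1 K u) (hv : A1 K v)
    {p : ℝ} (hp : 1 < p) (i : ℚ × ℚ) (h0 : volume (qI i) ≠ 0) :
    ∫⁻ x in qI i, wt p u v x ≤ K ^ (p - 1) *
      ((volume (qI i))⁻¹ * ∫⁻ y in qI i, v y) ^ (1 - p) * ∫⁻ y in qI i, u y := by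
  have hV0 := int_pos hv.meas hv.pos h0
  have hVt := hv.int_ne_top hK i h0
  rw [← lintegral_const_mul _ hu.meas]
  refine lintegral_mono_ae ?_
  filter_upwards [hv.avg i, ae_restrict_of_ae hv.pos, ae_restrict_of_ae hv.fin] with x h1 h2 h3
  unfold wt
  rw [mul_comm]
  refine mul_le_mul_left ?_ _
  obtain ⟨k, hk⟩ := EE_ex hK0 hK
  obtain ⟨b, hb⟩ := EE_ex h2 h3
  obtain ⟨c, hc⟩ := EE_ex hV0 hVt
  obtain ⟨l, hl⟩ := EE_ex h0 (vol_qI_ne_top i)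
  rw [hk, hb, hc, hl, EE_inv, EE_mul, EE_mul, EE_le] at h1
  rw [hk, hb, hc, hl, EE_inv, EE_mul, EE_rpow, EE_rpow, EE_rpow, EE_mul, EE_le]
  nlinarith

lemma wt_int_ne_top {K : ℝ≥0∞} (hK0 : K ≠ 0) (hK : K ≠ ⊤) {u v : ℝ → ℝ≥0∞} (hu : A1 K u)
    (hv : A1 K v) {p : ℝ} (hp : 1 < p) (i : ℚ × ℚ) (h0 : volume (qI i) ≠ 0) :
    ∫⁻ x in qI i, wt p u v x ≠ ⊤ := by
  refine ne_top_of_le_ne_top ?_ (wt_int hK0 hK hu hv hp i h0)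
  obtain ⟨k, hk⟩ := EE_ex hK0 hK
  obtain ⟨c, hc⟩ := EE_ex (int_pos hv.meas hv.pos h0) (hv.int_ne_top hK i h0)
  obtain ⟨d, hd⟩ := EE_ex (int_pos hu.meas hu.pos h0) (hu.int_ne_top hK i h0)
  obtain ⟨l, hl⟩ := EE_ex h0 (vol_qI_ne_top i)
  rw [hk, hc, hl, hd, EE_inv, EE_mul, EE_rpow, EE_rpow, EE_mul, EE_mul]
  exact EE_ne_top _

lemma Ap {K : ℝ≥0∞} (hK0 : K ≠ 0) (hK : K ≠ ⊤) {u v : ℝ → ℝ≥0∞} (hu : A1 K u) (hv : A1 K v)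
    {p q : ℝ} (hpq : p.HolderConjugate q) (i : ℚ × ℚ) (h0 : volume (qI i) ≠ 0) :
    ((volume (qI i))⁻¹ * ∫⁻ x in qI i, wt q v u x) ^ (p - 1) ≤
      K ^ p * volume (qI i) * (∫⁻ x in qI i, wt p u v x)⁻¹ := by
  have h1 := wt_int hK0 hK hu hv hpq.lt i h0
  have h2 := wt_int hK0 hK hv hu hpq.symm.lt i h0
  have p1 := int_pos (wt_meas (p := p) hu.meas hv.meas) ((wt_pos hu hv).mono fun x h => h.1) h0
  have p2 := int_pos (wt_meas (p := q) hv.meas hu.meas) ((wt_pos hv hu).mono fun x h => h.1) h0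
  obtain ⟨a, ha⟩ := EE_ex p1 (wt_int_ne_top hK0 hK hu hv hpq.lt i h0)
  obtain ⟨b, hb⟩ := EE_ex p2 (wt_int_ne_top hK0 hK hv hu hpq.symm.lt i h0)
  obtain ⟨k, hk⟩ := EE_ex hK0 hK
  obtain ⟨c, hc⟩ := EE_ex (int_pos hv.meas hv.pos h0) (hv.int_ne_top hK i h0)
  obtain ⟨d, hd⟩ := EE_ex (int_pos hu.meas hu.pos h0) (hu.int_ne_top hK i h0)
  obtain ⟨l, hl⟩ := EE_ex h0 (vol_qI_ne_top i)
  rw [ha, hk, hc, hl, hd, EE_inv, EE_mul, EE_rpow, EE_rpow, EE_mul, EE_mul, EE_le] at h1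
  rw [hb, hk, hc, hl, hd, EE_inv, EE_mul, EE_rpow, EE_rpow, EE_mul, EE_mul, EE_le] at h2
  rw [ha, hb, hk, hl, EE_inv, EE_inv, EE_mul, EE_rpow, EE_rpow, EE_mul, EE_mul, EE_le]
  have hpos : 0 ≤ p - 1 := hpq.sub_one_pos.le
  have h3 := mul_le_mul_of_nonneg_right h2 hpos
  have e : (q - 1) * (p - 1) = 1 := by
    have := hpq.mul_eq_add; nlinarith
  have e2 : (k * (q - 1) + (-l + d) * (1 - q) + c) * (p - 1) = k - (-l + d) + c * (p-1) := by
    linear_combination (k - (-l+d)) * e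
  rw [e2] at h3
  nlinarith

lemma muck {p q : ℝ} (hpq : p.HolderConjugate q) {K : ℝ≥0∞} (hK0 : K ≠ 0) (hK : K ≠ ⊤) :
    ∃ C : ℝ≥0∞, C ≠ ⊤ ∧ ∀ u v : ℝ → ℝ≥0∞, A1 K u → A1 K v → ∀ f : ℝ → ℝ≥0∞, Measurable f →
      ∫⁻ x, Mmax volume f x ^ p * wt p u v x ≤ C * ∫⁻ x, f x ^ p * wt p u v x := by
  obtain ⟨C1, hC1, H1⟩ := strong_type p hpq.lt
  obtain ⟨C2, hC2, H2⟩ := strong_type q hpq.symm.lt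
  have hp0 : 0 < p := hpq.pos
  have hq0 : 0 < q := hpq.symm.pos
  have hp1 : 0 < p - 1 := hpq.sub_one_pos
  have e : (q - 1) * (p - 1) = 1 := by
    have := hpq.mul_eq_add; nlinarith
  have e' : (p - 1) * q = p := by
    have := hpq.mul_eq_add; nlinarith
  refine ⟨(K ^ p) ^ q * C2 * C1, by finiteness, ?_⟩
  intro u v hu hv f hf
  set w := wt p u v with hw
  set s := wt q v u with hs
  have hwm : Measurable w := wt_meas hu.meas hv.meas
  have hsm : Measurable s := wt_meas hv.meas hu.meas
  have hwp : ∀ᵐ x, w x ≠ 0 ∧ w x ≠ ⊤ := wt_pos hu hv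
  have hsp : ∀ᵐ x, s x ≠ 0 ∧ s x ≠ ⊤ := wt_pos hv hu
  have hsw : ∀ᵐ x, s x ^ (1 - p) = w x := by
    filter_upwards [hu.pos, hu.fin, hv.pos, hv.fin] with x h1 h2 h3 h4
    obtain ⟨a, ha⟩ := EE_ex h1 h2
    obtain ⟨b, hb⟩ := EE_ex h3 h4
    rw [hs, hw]
    unfold wt
    rw [ha, hb, EE_rpow, EE_rpow, EE_mul, EE_mul, EE_rpow]
    congr 1
    linear_combination a * e
  set W := volume.withDensity w with hW
  set S := volume.withDensity s with hS
  set Φ := Mmax S (fun x => f x * (s x)⁻¹) with hΦ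
  have hΦm : Measurable Φ := Mmax_measurable _ _
  have hfs : Measurable (fun x => f x * (s x)⁻¹) := hf.mul hsm.inv
  have hΨ : Measurable (fun x => Φ x ^ (p - 1) * (w x)⁻¹) := (hΦm.pow_const _).mul hwm.inv
  have key : ∀ x, Mmax volume f x ^ (p - 1) ≤
      K ^ p * Mmax W (fun x => Φ x ^ (p - 1) * (w x)⁻¹) x := by
    intro x
    have : Mmax volume f x ≤ (K ^ p * Mmax W (fun x => Φ x ^ (p - 1) * (w x)⁻¹) x) ^ ((p - 1)⁻¹) := by
      refine Mmax_le fun i hi => ?_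
      rw [ENNReal.le_rpow_inv_iff hp1]
      have h0 : volume (qI i) ≠ 0 := by
        simp only [qI, mem_Ioo] at hi
        simp [qI]
        exact_mod_cast hi.1.trans hi.2
      set L := volume (qI i) with hL
      have hLt : L ≠ ⊤ := vol_qI_ne_top i
      have hWi : W (qI i) = ∫⁻ x in qI i, w x := withDensity_apply _ (qI_meas i)
      have hSi : S (qI i) = ∫⁻ x in qI i, s x := withDensity_apply _ (qI_meas i)
      have hS0 : S (qI i) ≠ 0 := by
        rw [hSi]; exact int_pos hsm (hsp.mono fun x h => h.1) h0
      have hSt : S (qI i) ≠ ⊤ := by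
        rw [hSi]; exact wt_int_ne_top hK0 hK hv hu hpq.symm.lt i h0
      have hJ : ∫⁻ y in qI i, f y * (s y)⁻¹ ∂S = ∫⁻ y in qI i, f y := by
        rw [hS, setLIntegral_withDensity_eq_setLIntegral_mul _ hsm hfs (qI_meas i)]
        refine lintegral_congr_ae ?_
        filter_upwards [ae_restrict_of_ae hsp] with y hy
        simp only [Pi.mul_apply]
        rw [mul_left_comm, ENNReal.mul_inv_cancel hy.1 hy.2, mul_one]
      set m := (S (qI i))⁻¹ * ∫⁻ y in qI i, f y * (s y)⁻¹ ∂S with hm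
      have hJm : ∫⁻ y in qI i, f y = S (qI i) * m := by
        rw [hm, hJ, ← mul_assoc, ENNReal.mul_inv_cancel hS0 hSt, one_mul]
      have hB : m ^ (p - 1) * L ≤ ∫⁻ y in qI i, Φ y ^ (p - 1) * (w y)⁻¹ ∂W := by
        rw [hW, setLIntegral_withDensity_eq_setLIntegral_mul _ hwm hΨ (qI_meas i)]
        rw [← setLIntegral_const]
        refine lintegral_mono_ae ?_
        filter_upwards [ae_restrict_of_ae hwp, ae_restrict_mem (qI_meas i)] with y hy hyi
        simp only [Pi.mul_apply]
        rw [mul_left_comm, ENNReal.mul_inv_cancel hy.1 hy.2, mul_one]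
        exact ENNReal.rpow_le_rpow (le_Mmax S _ i hyi) hp1.le
      calc (L⁻¹ * ∫⁻ y in qI i, f y) ^ (p - 1) = (L⁻¹ * S (qI i)) ^ (p - 1) * m ^ (p - 1) := by
            rw [hJm, ← mul_assoc, ENNReal.mul_rpow_of_nonneg _ _ hp1.le]
        _ ≤ (K ^ p * L * (W (qI i))⁻¹) * m ^ (p - 1) := by
            gcongr
            rw [hSi, hWi]
            exact Ap hK0 hK hu hv hpq i h0
        _ = K ^ p * ((W (qI i))⁻¹ * (m ^ (p - 1) * L)) := by ring
        _ ≤ K ^ p * ((W (qI i))⁻¹ * ∫⁻ y in qI i, Φ y ^ (p - 1) * (w y)⁻¹ ∂W) := by gcongr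
        _ ≤ _ := by
            gcongr
            exact le_Mmax W (fun x => Φ x ^ (p - 1) * (w x)⁻¹) i hi
    rwa [ENNReal.le_rpow_inv_iff hp1] at this
  calc ∫⁻ x, Mmax volume f x ^ p * w x
      ≤ ∫⁻ x, (K ^ p) ^ q * (Mmax W (fun x => Φ x ^ (p - 1) * (w x)⁻¹) x ^ q * w x) := by
        refine lintegral_mono fun x => ?_
        rw [← mul_assoc, ← ENNReal.mul_rpow_of_nonneg _ _ hq0.le]
        gcongr
        have := ENNReal.rpow_le_rpow (key x) hq0.le
        rwa [← ENNReal.rpow_mul, e'] at this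
    _ = (K ^ p) ^ q * ∫⁻ x, Mmax W (fun x => Φ x ^ (p - 1) * (w x)⁻¹) x ^ q ∂W := by
        have hMm : Measurable (fun x => Mmax W (fun x => Φ x ^ (p - 1) * (w x)⁻¹) x ^ q) :=
          (Mmax_measurable _ _).pow_const q
        have hMw : Measurable (fun x => Mmax W (fun x => Φ x ^ (p - 1) * (w x)⁻¹) x ^ q * w x) :=
          hMm.mul hwm
        rw [lintegral_const_mul _ hMw, hW,
          lintegral_withDensity_eq_lintegral_mul _ hwm hMm]
        simp only [Pi.mul_apply, mul_comm, ← hW]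
    _ ≤ (K ^ p) ^ q * (C2 * ∫⁻ x, (Φ x ^ (p - 1) * (w x)⁻¹) ^ q ∂W) := by
        gcongr
        exact H2 W _ hΨ
    _ = (K ^ p) ^ q * (C2 * ∫⁻ x, Φ x ^ p ∂S) := by
        congr 2
        rw [hW, hS, lintegral_withDensity_eq_lintegral_mul _ hwm (hΨ.pow_const q),
          lintegral_withDensity_eq_lintegral_mul _ hsm (hΦm.pow_const p)]
        refine lintegral_congr_ae ?_
        filter_upwards [hwp, hsp, hsw] with x h1 h2 h3
        simp only [Pi.mul_apply]
        rw [ENNReal.mul_rpow_of_nonneg _ _ hq0.le, ← ENNReal.rpow_mul, e', mul_left_comm, mul_comm]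
        congr 1
        rw [← h3]
        obtain ⟨a, ha⟩ := EE_ex h2.1 h2.2
        rw [ha, EE_rpow, EE_inv, EE_rpow, EE_mul]
        congr 1
        linear_combination a * e'
    _ ≤ (K ^ p) ^ q * (C2 * (C1 * ∫⁻ x, (f x * (s x)⁻¹) ^ p ∂S)) := by
        gcongr
        exact H1 S _ hfs
    _ = (K ^ p) ^ q * (C2 * (C1 * ∫⁻ x, f x ^ p * w x)) := by
        congr 3
        rw [hS, lintegral_withDensity_eq_lintegral_mul _ hsm (hfs.pow_const p)]
        refine lintegral_congr_ae ?_
        filter_upwards [hsp, hsw] with x h2 h3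
        simp only [Pi.mul_apply]
        rw [ENNReal.mul_rpow_of_nonneg _ _ hp0.le, mul_left_comm]
        congr 1
        rw [← h3]
        obtain ⟨a, ha⟩ := EE_ex h2.1 h2.2
        rw [ha, EE_rpow, EE_inv, EE_rpow, EE_mul]
        congr 1
        ring
    _ = _ := by ring

lemma rpow_iSup' {ι : Sort*} (f : ι → ℝ≥0∞) {p : ℝ} (hp : 0 < p) :
    (⨆ i, f i) ^ p = ⨆ i, f i ^ p :=
  (ENNReal.orderIsoRpow p hp).map_iSup f

lemma Mmax_mono {μ : Measure ℝ} {f g : ℝ → ℝ≥0∞} (h : ∀ x, f x ≤ g x) (x : ℝ) :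
    Mmax μ f x ≤ Mmax μ g x :=
  Mmax_le fun i hi => le_trans (by gcongr; exact h _) (le_Mmax μ g i hi)

lemma Mmax_pos {k : ℝ → ℝ≥0∞} (hk : Measurable k) (hne : ¬ ∀ᵐ x, k x = 0) (x : ℝ) :
    Mmax volume k x ≠ 0 := by
  intro h0
  apply hne
  obtain ⟨n0, hn0⟩ := exists_nat_gt |x|
  have h1 : ∀ n : ℕ, ∀ᵐ y ∂(volume.restrict (Ioo (-((n0 + n : ℕ) : ℝ)) ((n0 + n : ℕ) : ℝ))), k y = 0 := by
    intro n
    have hI : qI (-((n0 + n : ℕ) : ℚ), ((n0 + n : ℕ) : ℚ)) =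
        Ioo (-((n0 + n : ℕ) : ℝ)) ((n0 + n : ℕ) : ℝ) := by
      simp [qI]
    have hx : x ∈ qI (-((n0 + n : ℕ) : ℚ), ((n0 + n : ℕ) : ℚ)) := by
      rw [hI]
      have : |x| < ((n0 + n : ℕ) : ℝ) := by
        push_cast
        have : (0:ℝ) ≤ n := n.cast_nonneg
        linarith
      exact abs_lt.1 this
    have h2 := le_Mmax volume k _ hx
    rw [h0, nonpos_iff_eq_zero, mul_eq_zero] at h2
    rcases h2 with h2 | h2
    · rw [ENNReal.inv_eq_zero] at h2
      exact absurd h2 (vol_qI_ne_top _)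
    · rw [hI, lintegral_eq_zero_iff hk] at h2
      exact h2
  have h3 := (ae_restrict_iUnion_iff (μ := volume)
    (fun n : ℕ => Ioo (-((n0 + n : ℕ) : ℝ)) ((n0 + n : ℕ) : ℝ)) (fun y => k y = 0)).2 h1
  have h4 : (⋃ n : ℕ, Ioo (-((n0 + n : ℕ) : ℝ)) ((n0 + n : ℕ) : ℝ)) = univ := by
    refine eq_univ_of_forall fun y => ?_
    obtain ⟨n, hn⟩ := exists_nat_gt |y|
    refine mem_iUnion.2 ⟨n, ?_⟩
    have : |y| < ((n0 + n : ℕ) : ℝ) := by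
      push_cast
      have : (0:ℝ) ≤ n0 := n0.cast_nonneg
      linarith
    exact abs_lt.1 this
  rw [h4, Measure.restrict_univ] at h3
  exact h3

lemma rdf {p q : ℝ} (hpq : p.HolderConjugate q) {K : ℝ≥0∞} (hK0 : K ≠ 0) (hK : K ≠ ⊤) :
    ∃ K' : ℝ≥0∞, K' ≠ 0 ∧ K' ≠ ⊤ ∧ ∀ u v : ℝ → ℝ≥0∞, A1 K u → A1 K v → ∀ k : ℝ → ℝ≥0∞,
      Measurable k → (¬ ∀ᵐ x, k x = 0) → ∫⁻ x, k x ^ p * wt p u v x ≠ ⊤ →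
      ∃ H : ℝ → ℝ≥0∞, A1 K' H ∧ (∀ x, k x ≤ H x) ∧
        ∫⁻ x, H x ^ p * wt p u v x ≤ 2 ^ p * ∫⁻ x, k x ^ p * wt p u v x := by
  obtain ⟨C, hC, hmuck⟩ := muck hpq hK0 hK
  have hp0 : 0 < p := hpq.pos
  set B : ℝ≥0∞ := (C + 1) ^ (1 / p) with hB
  have hB0 : B ≠ 0 := by
    rw [hB]; simp [ENNReal.rpow_eq_zero_iff, hp0, hp0.le]
  have hBt : B ≠ ⊤ := by
    rw [hB]
    exact ENNReal.rpow_ne_top_of_nonneg (by positivity) (by finiteness)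
  have hBp : C ≤ B ^ p := by
    rw [hB, ← ENNReal.rpow_mul, one_div_mul_cancel hp0.ne', ENNReal.rpow_one]
    exact le_self_add
  have h2B0 : 2 * B ≠ 0 := mul_ne_zero (by norm_num) hB0
  have h2Bt : 2 * B ≠ ⊤ := ENNReal.mul_ne_top (by norm_num) hBt
  refine ⟨2 * B, h2B0, h2Bt, ?_⟩
  intro u v hu hv k hk hkne hkt
  set w := wt p u v with hw
  have hwm : Measurable w := wt_meas hu.meas hv.meas
  have hwp : ∀ᵐ x, w x ≠ 0 ∧ w x ≠ ⊤ := wt_pos hu hv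
  set W := volume.withDensity w with hW
  have hwint : ∀ f : ℝ → ℝ≥0∞, Measurable f → ∫⁻ x, f x ^ p * w x = ∫⁻ x, f x ^ p ∂W := by
    intro f hf
    rw [hW, lintegral_withDensity_eq_lintegral_mul _ hwm (hf.pow_const p)]
    simp only [Pi.mul_apply, mul_comm]
  let S : ℕ → ℝ → ℝ≥0∞ := fun n => Nat.rec (fun _ => 0)
    (fun _ s => fun x => k x + (2 * B)⁻¹ * Mmax volume s x) n
  have hS0 : S 0 = fun _ => 0 := rfl
  have hSs : ∀ n, S (n + 1) = fun x => k x + (2 * B)⁻¹ * Mmax volume (S n) x := fun n => rfl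
  have hSm : ∀ n, Measurable (S n) := by
    intro n
    cases n with
    | zero => exact measurable_const
    | succ n => rw [hSs]; exact hk.add ((Mmax_measurable _ _).const_mul _)
  have hmono1 : ∀ n x, S n x ≤ S (n + 1) x := by
    intro n
    induction n with
    | zero => intro x; simp [hS0]
    | succ n ih =>
      intro x
      rw [hSs n, hSs (n + 1)]
      dsimp only
      gcongr
      exact Mmax_mono ih x
  have hmono : Monotone S := monotone_nat_of_le_succ fun n x => hmono1 n x
  have hN : ∀ n, (∫⁻ x, S n x ^ p ∂W) ^ (1 / p) ≤ 2 * (∫⁻ x, k x ^ p ∂W) ^ (1 / p) := by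
    intro n
    induction n with
    | zero =>
      simp only [hS0, ENNReal.zero_rpow_of_pos hp0, lintegral_zero]
      rw [ENNReal.zero_rpow_of_pos (by positivity)]
      exact zero_le
    | succ n ih =>
      have hMm := Mmax_measurable volume (S n)
      have h1 := ENNReal.lintegral_Lp_add_le (μ := W) hk.aemeasurable
        (hMm.const_mul (2 * B)⁻¹).aemeasurable hpq.lt.le
      have h2 : (∫⁻ x, ((2 * B)⁻¹ * Mmax volume (S n) x) ^ p ∂W) ^ (1 / p) ≤
          (∫⁻ x, k x ^ p ∂W) ^ (1 / p) := by
        calc (∫⁻ x, ((2 * B)⁻¹ * Mmax volume (S n) x) ^ p ∂W) ^ (1 / p)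
            = (((2 * B)⁻¹) ^ p * ∫⁻ x, (Mmax volume (S n) x) ^ p ∂W) ^ (1 / p) := by
              congr 1
              rw [← lintegral_const_mul _ (hMm.pow_const p)]
              refine lintegral_congr fun x => ?_
              rw [ENNReal.mul_rpow_of_nonneg _ _ hp0.le]
          _ ≤ (((2 * B)⁻¹) ^ p * (B ^ p * ∫⁻ x, (S n x) ^ p ∂W)) ^ (1 / p) := by
              gcongr
              rw [← hwint _ hMm, ← hwint _ (hSm n)]
              refine (hmuck u v hu hv _ (hSm n)).trans ?_
              gcongr
          _ = (2 * B)⁻¹ * B * (∫⁻ x, (S n x) ^ p ∂W) ^ (1 / p) := by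
              rw [← mul_assoc, ← ENNReal.mul_rpow_of_nonneg _ _ hp0.le,
                ENNReal.mul_rpow_of_nonneg _ _ (by positivity), ← ENNReal.rpow_mul,
                mul_one_div_cancel hp0.ne', ENNReal.rpow_one]
          _ ≤ (2 * B)⁻¹ * B * (2 * (∫⁻ x, k x ^ p ∂W) ^ (1 / p)) := by gcongr
          _ = ((2 * B)⁻¹ * (2 * B)) * (∫⁻ x, k x ^ p ∂W) ^ (1 / p) := by ring
          _ = _ := by rw [ENNReal.inv_mul_cancel h2B0 h2Bt, one_mul]
      rw [two_mul]
      refine le_trans ?_ (add_le_add_right h2 _)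
      exact h1
  set H : ℝ → ℝ≥0∞ := fun x => ⨆ n, S n x with hH
  have hHm : Measurable H := Measurable.iSup hSm
  have hHS : ∀ n x, S n x ≤ H x := fun n x => le_iSup (fun n => S n x) n
  have hHk : ∀ x, k x ≤ H x := by
    intro x
    refine le_trans ?_ (hHS 1 x)
    rw [show S 1 = _ from hSs 0]
    exact le_self_add
  have hHint : ∫⁻ x, H x ^ p ∂W ≤ 2 ^ p * ∫⁻ x, k x ^ p ∂W := by
    have : ∀ x, H x ^ p = ⨆ n, S n x ^ p := fun x => rpow_iSup' _ hp0
    simp_rw [this]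
    rw [lintegral_iSup (fun n => (hSm n).pow_const p)
      (fun a b hab x => ENNReal.rpow_le_rpow (hmono hab x) hp0.le)]
    refine iSup_le fun n => ?_
    have h := ENNReal.rpow_le_rpow (hN n) hp0.le
    rw [ENNReal.mul_rpow_of_nonneg _ _ hp0.le, ← ENNReal.rpow_mul, ← ENNReal.rpow_mul,
      one_div_mul_cancel hp0.ne', ENNReal.rpow_one, ENNReal.rpow_one] at h
    exact h
  have hHint' : ∫⁻ x, H x ^ p * w x ≤ 2 ^ p * ∫⁻ x, k x ^ p * w x := by
    rw [hwint _ hHm, hwint _ hk]; exact hHint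
  refine ⟨H, ⟨hHm, ?_, ?_, ?_⟩, hHk, hHint'⟩
  · refine Filter.Eventually.of_forall fun x h0 => ?_
    have h1 : (2 * B)⁻¹ * Mmax volume k x ≤ H x := by
      refine le_trans ?_ (hHS 2 x)
      rw [show S 2 = _ from hSs 1]
      dsimp only
      refine le_trans ?_ le_add_self
      gcongr
      refine Mmax_mono (fun y => ?_) x
      rw [show S 1 = _ from hSs 0]
      exact le_self_add
    rw [h0, nonpos_iff_eq_zero, mul_eq_zero] at h1
    rcases h1 with h1 | h1
    · exact h2Bt (ENNReal.inv_eq_zero.1 h1)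
    · exact Mmax_pos hk hkne x h1
  · have ht : ∫⁻ x, H x ^ p * w x ≠ ⊤ :=
      ne_top_of_le_ne_top (ENNReal.mul_ne_top (by finiteness) hkt) hHint'
    filter_upwards [ae_lt_top ((hHm.pow_const p).mul hwm) ht, hwp] with x h1 h2 h3
    simp only [Pi.mul_apply, h3, ENNReal.top_rpow_of_pos hp0, ENNReal.top_mul h2.1] at h1
    exact lt_irrefl _ h1
  · refine Filter.Eventually.of_forall fun x => Mmax_le fun i hi => ?_
    have : ∫⁻ y in qI i, H y = ⨆ n, ∫⁻ y in qI i, S n y := lintegral_iSup hSm hmono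
    rw [this, ENNReal.mul_iSup]
    refine iSup_le fun n => ?_
    calc _ ≤ Mmax volume (S n) x := le_Mmax _ _ i hi
      _ = 2 * B * ((2 * B)⁻¹ * Mmax volume (S n) x) := by
        rw [← mul_assoc, ENNReal.mul_inv_cancel h2B0 h2Bt, one_mul]
      _ ≤ 2 * B * S (n + 1) x := by
        gcongr
        rw [hSs]
        exact le_add_self
      _ ≤ _ := mul_le_mul' le_rfl (hHS (n + 1) x)

lemma A1.mono {K K' : ℝ≥0∞} (h : K ≤ K') {u : ℝ → ℝ≥0∞} (hu : A1 K u) : A1 K' u :=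
  ⟨hu.meas, hu.pos, hu.fin, hu.le.mono fun x hx => hx.trans (by gcongr)⟩

lemma ae_zero_of_wt {p : ℝ} (hp : 0 < p) {w f : ℝ → ℝ≥0∞} (hw : Measurable w) (hf : Measurable f)
    (hwp : ∀ᵐ x, w x ≠ 0 ∧ w x ≠ ⊤) (h : ∫⁻ x, f x ^ p * w x = 0) : ∀ᵐ x, f x = 0 := by
  have hm : Measurable (fun x => f x ^ p * w x) := (hf.pow_const p).mul hw
  rw [lintegral_eq_zero_iff hm] at h
  filter_upwards [h, hwp] with x h1 h2
  simp only [Pi.zero_apply, mul_eq_zero, h2.1, or_false] at h1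
  exact (ENNReal.rpow_eq_zero_iff_of_pos hp).1 h1

lemma zero_of_ae_zero {p : ℝ} (hp : 0 < p) {w f : ℝ → ℝ≥0∞}
    (h : ∀ᵐ x, f x = 0) : ∫⁻ x, f x ^ p * w x = 0 := by
  refine (lintegral_congr_ae (g := fun _ => 0) ?_).trans lintegral_zero
  filter_upwards [h] with x hx
  simp [hx, hp]

/-- The core of the extrapolation argument, for functions with finite norm. -/
lemma extrap_core {p q p0 q0 : ℝ} (hpq : p.HolderConjugate q) (hpq0 : p0.HolderConjugate q0)
    {K K' C0 : ℝ≥0∞} {u v F H1 H2 G : ℝ → ℝ≥0∞}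
    (hu : A1 K u) (hv : A1 K v) (hF : Measurable F)
    (h1 : A1 K' H1) (h2 : A1 K' H2) (hG : ∀ x, G x ≤ H1 x)
    (hF2 : ∀ x, F x ^ (p - 1) * wt p u v x ≤ H2 x)
    (hyp : ∫⁻ x, F x ^ p0 * wt p0 H2 H1 x ≤ C0 * ∫⁻ x, G x ^ p0 * wt p0 H2 H1 x)
    (hn1 : ∫⁻ x, H1 x ^ p * wt p u v x ≤ 2 ^ p * ∫⁻ x, G x ^ p * wt p u v x)
    (hn2 : ∫⁻ x, H2 x ^ q * wt q v u x ≤ 2 ^ q * ∫⁻ x, F x ^ p * wt p u v x)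
    (hX0 : ∫⁻ x, F x ^ p * wt p u v x ≠ 0) (hXt : ∫⁻ x, F x ^ p * wt p u v x ≠ ⊤) :
    ∫⁻ x, F x ^ p * wt p u v x ≤ (C0 ^ (1 / p0) * 4) ^ p * ∫⁻ x, G x ^ p * wt p u v x := by
  have hp : 0 < p := hpq.pos
  have hq : 0 < q := hpq.symm.pos
  have hp0 : 0 < p0 := hpq0.pos
  have hq0 : 0 < q0 := hpq0.symm.pos
  have e1 : 1 / p + 1 / q = 1 := by simpa using hpq.inv_add_inv_eq_one
  have e2 : 1 / p0 + 1 / q0 = 1 := by simpa using hpq0.inv_add_inv_eq_one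
  set X := ∫⁻ x, F x ^ p * wt p u v x with hX
  set Y := ∫⁻ x, G x ^ p * wt p u v x with hY
  set D := ∫⁻ x, H1 x * H2 x with hD
  have hwm : Measurable (wt p u v) := wt_meas hu.meas hv.meas
  have hsm : Measurable (wt q v u) := wt_meas hv.meas hu.meas
  have hw0m : Measurable (wt p0 H2 H1) := wt_meas h2.meas h1.meas
  have hDle : D ≤ (2 * Y ^ (1 / p)) * (2 * X ^ (1 / q)) := by
    have hh := ENNReal.lintegral_mul_le_Lp_mul_Lq volume hpq
      (f := fun x => H1 x * wt p u v x ^ (1 / p)) (g := fun x => H2 x * wt q v u x ^ (1 / q))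
      (h1.meas.mul (hwm.pow_const _)).aemeasurable (h2.meas.mul (hsm.pow_const _)).aemeasurable
    have a1 : D = ∫⁻ a, ((fun x => H1 x * wt p u v x ^ (1 / p)) *
        (fun x => H2 x * wt q v u x ^ (1 / q))) a := by
      refine lintegral_congr_ae ?_
      filter_upwards [hu.pos, hu.fin, hv.pos, hv.fin] with x b1 b2 b3 b4
      obtain ⟨a, ha⟩ := EE_ex b1 b2
      obtain ⟨b, hb⟩ := EE_ex b3 b4
      simp only [Pi.mul_apply]
      rw [mul_mul_mul_comm]
      have : wt p u v x ^ (1 / p) * wt q v u x ^ (1 / q) = 1 := by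
        unfold wt
        rw [ha, hb, EE_rpow, EE_rpow, EE_mul, EE_mul, EE_rpow, EE_rpow, EE_mul]
        have : (a + b * (1 - p)) * (1 / p) + (b + a * (1 - q)) * (1 / q) = 0 := by
          have c1 : p * (1 / p) = 1 := mul_one_div_cancel hp.ne'
          have c2 : q * (1 / q) = 1 := mul_one_div_cancel hq.ne'
          linear_combination (a + b) * e1 - b * c1 - a * c2
        rw [this]
        simp [EE]
      rw [this, mul_one]
    have a2 : ∫⁻ x, (H1 x * wt p u v x ^ (1 / p)) ^ p = ∫⁻ x, H1 x ^ p * wt p u v x := by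
      refine lintegral_congr fun x => ?_
      rw [ENNReal.mul_rpow_of_nonneg _ _ hp.le, ← ENNReal.rpow_mul, one_div_mul_cancel hp.ne',
        ENNReal.rpow_one]
    have a3 : ∫⁻ x, (H2 x * wt q v u x ^ (1 / q)) ^ q = ∫⁻ x, H2 x ^ q * wt q v u x := by
      refine lintegral_congr fun x => ?_
      rw [ENNReal.mul_rpow_of_nonneg _ _ hq.le, ← ENNReal.rpow_mul, one_div_mul_cancel hq.ne',
        ENNReal.rpow_one]
    rw [← a1, a2, a3] at hh
    refine hh.trans (mul_le_mul' ?_ ?_)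
    · calc _ ≤ (2 ^ p * Y) ^ (1 / p) := by gcongr
        _ = _ := by
          rw [ENNReal.mul_rpow_of_nonneg _ _ (by positivity), ← ENNReal.rpow_mul,
            mul_one_div_cancel hp.ne', ENNReal.rpow_one]
    · calc _ ≤ (2 ^ q * X) ^ (1 / q) := by gcongr
        _ = _ := by
          rw [ENNReal.mul_rpow_of_nonneg _ _ (by positivity), ← ENNReal.rpow_mul,
            mul_one_div_cancel hq.ne', ENNReal.rpow_one]
  have hXle : X ≤ ∫⁻ x, F x * H2 x := by
    refine lintegral_mono fun x => ?_
    calc F x ^ p * wt p u v x = F x * (F x ^ (p - 1) * wt p u v x) := by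
          rw [← mul_assoc]
          congr 1
          have : F x * F x ^ (p-1) = F x ^ (1:ℝ) * F x ^ (p-1) := by rw [ENNReal.rpow_one]
          rw [this, ← ENNReal.rpow_add_of_nonneg _ _ (by norm_num) hpq.sub_one_pos.le]
          congr 1; ring
      _ ≤ _ := by gcongr; exact hF2 x
  have hFH : ∫⁻ x, F x * H2 x ≤ C0 ^ (1 / p0) * D := by
    have hh := ENNReal.lintegral_mul_le_Lp_mul_Lq volume hpq0
      (f := fun x => F x * wt p0 H2 H1 x ^ (1 / p0)) (g := fun x => (H1 x * H2 x) ^ (1 / q0))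
      (hF.mul (hw0m.pow_const _)).aemeasurable ((h1.meas.mul h2.meas).pow_const _).aemeasurable
    have a1 : ∫⁻ x, F x * H2 x = ∫⁻ a, ((fun x => F x * wt p0 H2 H1 x ^ (1 / p0)) *
        (fun x => (H1 x * H2 x) ^ (1 / q0))) a := by
      refine lintegral_congr_ae ?_
      filter_upwards [h1.pos, h1.fin, h2.pos, h2.fin] with x b1 b2 b3 b4
      obtain ⟨a, ha⟩ := EE_ex b1 b2
      obtain ⟨b, hb⟩ := EE_ex b3 b4
      simp only [Pi.mul_apply]
      rw [mul_assoc]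
      congr 1
      unfold wt
      rw [ha, hb, EE_rpow, EE_mul, EE_mul, EE_rpow, EE_rpow, EE_mul]
      congr 1
      have c1 : p0 * (1 / p0) = 1 := mul_one_div_cancel hp0.ne'
      linear_combination (-a - b) * e2 + a * c1
    have a2 : ∫⁻ x, (F x * wt p0 H2 H1 x ^ (1 / p0)) ^ p0 = ∫⁻ x, F x ^ p0 * wt p0 H2 H1 x := by
      refine lintegral_congr fun x => ?_
      rw [ENNReal.mul_rpow_of_nonneg _ _ hp0.le, ← ENNReal.rpow_mul, one_div_mul_cancel hp0.ne',
        ENNReal.rpow_one]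
    have a3 : ∫⁻ x, ((H1 x * H2 x) ^ (1 / q0)) ^ q0 = D := by
      refine lintegral_congr fun x => ?_
      rw [← ENNReal.rpow_mul, one_div_mul_cancel hq0.ne', ENNReal.rpow_one]
    have a4 : ∫⁻ x, G x ^ p0 * wt p0 H2 H1 x ≤ D := by
      refine lintegral_mono_ae ?_
      filter_upwards [h1.pos, h1.fin, h2.pos, h2.fin] with x b1 b2 b3 b4
      refine le_trans (mul_le_mul_left (ENNReal.rpow_le_rpow (hG x) hp0.le) _) ?_
      obtain ⟨a, ha⟩ := EE_ex b1 b2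
      obtain ⟨b, hb⟩ := EE_ex b3 b4
      unfold wt
      rw [ha, hb, EE_rpow, EE_rpow, EE_mul, EE_mul, EE_mul]
      rw [EE_le]
      linarith
    rw [← a1, a2, a3] at hh
    refine hh.trans ?_
    calc _ ≤ (C0 * D) ^ (1 / p0) * D ^ (1 / q0) := by
          gcongr
          exact hyp.trans (by gcongr)
      _ = _ := by
          rw [ENNReal.mul_rpow_of_nonneg _ _ (by positivity), mul_assoc,
            ← ENNReal.rpow_add_of_nonneg _ _ (by positivity) (by positivity), e2, ENNReal.rpow_one]
  have hfin : X ≤ C0 ^ (1 / p0) * 4 * Y ^ (1 / p) * X ^ (1 / q) := by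
    refine (hXle.trans hFH).trans ?_
    calc _ ≤ C0 ^ (1 / p0) * ((2 * Y ^ (1 / p)) * (2 * X ^ (1 / q))) := by gcongr
      _ = _ := by ring
  have hXq0 : X ^ (1 / q) ≠ 0 := by
    intro h
    exact hX0 ((ENNReal.rpow_eq_zero_iff_of_pos (by positivity)).1 h)
  have hXqt : X ^ (1 / q) ≠ ⊤ := ENNReal.rpow_ne_top_of_nonneg (by positivity) hXt
  have hX1 : X = X ^ (1 / p) * X ^ (1 / q) := by
    rw [← ENNReal.rpow_add_of_nonneg _ _ (by positivity) (by positivity), e1, ENNReal.rpow_one]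
  have h3 : X ^ (1 / p) ≤ C0 ^ (1 / p0) * 4 * Y ^ (1 / p) := by
    rw [← ENNReal.mul_le_mul_iff_left hXq0 hXqt, ← hX1]
    exact hfin
  have h4 := ENNReal.rpow_le_rpow h3 hp.le
  rwa [ENNReal.mul_rpow_of_nonneg _ _ hp.le, ← ENNReal.rpow_mul, ← ENNReal.rpow_mul,
      one_div_mul_cancel hp.ne', ENNReal.rpow_one, ENNReal.rpow_one] at h4

/-- Extrapolation, for functions with finite norm. -/
lemma extrap_fin {p q p0 q0 : ℝ} (hpq : p.HolderConjugate q) (hpq0 : p0.HolderConjugate q0)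
    {K : ℝ≥0∞} (hK0 : K ≠ 0) (hK : K ≠ ⊤) :
    ∃ K' : ℝ≥0∞, K ≤ K' ∧ K' ≠ ⊤ ∧ ∀ (C0 : ℝ≥0∞) (F G : ℝ → ℝ≥0∞), Measurable F →
      Measurable G → (∀ u v, A1 K' u → A1 K' v →
        ∫⁻ x, F x ^ p0 * wt p0 u v x ≤ C0 * ∫⁻ x, G x ^ p0 * wt p0 u v x) →
      ∀ u v, A1 K u → A1 K v → ∫⁻ x, F x ^ p * wt p u v x ≠ ⊤ →
        ∫⁻ x, G x ^ p * wt p u v x ≠ ⊤ → ∫⁻ x, G x ^ p * wt p u v x ≠ 0 →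
        ∫⁻ x, F x ^ p * wt p u v x ≤ (C0 ^ (1 / p0) * 4) ^ p * ∫⁻ x, G x ^ p * wt p u v x := by
  obtain ⟨K1, hK10, hK1t, R1⟩ := rdf hpq hK0 hK
  obtain ⟨K2, hK20, hK2t, R2⟩ := rdf hpq.symm hK0 hK
  refine ⟨K + K1 + K2, by rw [add_assoc]; exact le_self_add, by finiteness, ?_⟩
  intro C0 F G hF hG hyp u v hu hv hFt hGt hG0
  by_cases hF0 : ∫⁻ x, F x ^ p * wt p u v x = 0
  · rw [hF0]; exact zero_le
  have hGne : ¬ ∀ᵐ x, G x = 0 := fun h => hG0 (zero_of_ae_zero hpq.pos h)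
  have hFne : ¬ ∀ᵐ x, F x = 0 := fun h => hF0 (zero_of_ae_zero hpq.pos h)
  obtain ⟨H1, h1, hG1, hn1⟩ := R1 u v hu hv G hG hGne hGt
  have hwm : Measurable (wt p u v) := wt_meas hu.meas hv.meas
  have hwp : ∀ᵐ x, wt p u v x ≠ 0 ∧ wt p u v x ≠ ⊤ := wt_pos hu hv
  have hp1 : 0 < p - 1 := hpq.sub_one_pos
  have e' : (p - 1) * q = p := by
    have := hpq.mul_eq_add; nlinarith
  have e : (p - 1) * (q - 1) = 1 := by
    have := hpq.mul_eq_add; nlinarith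
  have hwint : ∫⁻ x, (F x ^ (p - 1) * wt p u v x) ^ q * wt q v u x =
      ∫⁻ x, F x ^ p * wt p u v x := by
    refine lintegral_congr_ae ?_
    filter_upwards [hu.pos, hu.fin, hv.pos, hv.fin] with x b1 b2 b3 b4
    obtain ⟨a, ha⟩ := EE_ex b1 b2
    obtain ⟨b, hb⟩ := EE_ex b3 b4
    rw [ENNReal.mul_rpow_of_nonneg _ _ hpq.symm.pos.le, ← ENNReal.rpow_mul, e', mul_assoc]
    congr 1
    unfold wt
    rw [ha, hb, EE_rpow, EE_rpow, EE_mul, EE_mul, EE_rpow, EE_mul]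
    congr 1
    linear_combination (-b) * e
  have hkne : ¬ ∀ᵐ x, F x ^ (p - 1) * wt p u v x = 0 := by
    intro h
    apply hFne
    filter_upwards [h, hwp] with x c1 c2
    rw [mul_eq_zero, or_iff_left c2.1] at c1
    exact (ENNReal.rpow_eq_zero_iff_of_pos hp1).1 c1
  obtain ⟨H2, h2, hF2, hn2⟩ := R2 v u hv hu (fun x => F x ^ (p - 1) * wt p u v x)
    ((hF.pow_const _).mul hwm) hkne (by rw [hwint]; exact hFt)
  rw [hwint] at hn2
  have h1' : A1 (K + K1 + K2) H1 := h1.mono (by rw [add_assoc, add_left_comm]; exact le_self_add)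
  have h2' : A1 (K + K1 + K2) H2 := h2.mono le_add_self
  exact extrap_core hpq hpq0 hu hv hF h1' h2' hG1 hF2 (hyp H2 H1 h2' h1') hn1 hn2 hF0 hFt

lemma extrap {p p0 : ℝ} (hp : 1 < p) (hp0 : 1 < p0) {K : ℝ≥0∞} (hK0 : K ≠ 0) (hK : K ≠ ⊤) :
    ∃ K' : ℝ≥0∞, K' ≠ 0 ∧ K' ≠ ⊤ ∧ ∀ C0 : ℝ≥0∞, C0 ≠ ⊤ → ∃ C : ℝ≥0∞, C ≠ ⊤ ∧
      ∀ (F G : ℝ → ℝ≥0∞), Measurable F →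
      Measurable G → (∀ u v, A1 K' u → A1 K' v →
        ∫⁻ x, F x ^ p0 * wt p0 u v x ≤ C0 * ∫⁻ x, G x ^ p0 * wt p0 u v x) →
      ∀ u v, A1 K u → A1 K v →
        ∫⁻ x, F x ^ p * wt p u v x ≤ C * ∫⁻ x, G x ^ p * wt p u v x := by
  have hpq := Real.HolderConjugate.conjExponent hp
  have hpq0 := Real.HolderConjugate.conjExponent hp0
  obtain ⟨K', hKK, hK', R⟩ := extrap_fin hpq hpq0 hK0 hK
  have hp' : 0 < p := hpq.pos
  have hp0' : 0 < p0 := hpq0.pos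
  refine ⟨K', fun h => hK0 (nonpos_iff_eq_zero.1 (h ▸ hKK)), hK', fun C0 hC0 =>
    ⟨(C0 ^ (1 / p0) * 4) ^ p + 1, ?_, ?_⟩⟩
  · have h1 : C0 ^ (1 / p0) ≠ ⊤ := ENNReal.rpow_ne_top_of_nonneg (by positivity) hC0
    have h2 : (C0 ^ (1 / p0) * 4) ^ p ≠ ⊤ :=
      ENNReal.rpow_ne_top_of_nonneg hp'.le (ENNReal.mul_ne_top h1 (by norm_num))
    finiteness
  intro F G hF hG hyp u v hu hv
  have hwm : Measurable (wt p u v) := wt_meas hu.meas hv.meas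
  have hwp : ∀ᵐ x, wt p u v x ≠ 0 ∧ wt p u v x ≠ ⊤ := wt_pos hu hv
  by_cases hY : ∫⁻ x, G x ^ p * wt p u v x = ⊤
  · rw [hY, ENNReal.mul_top (by simp)]; exact le_top
  by_cases hY0 : ∫⁻ x, G x ^ p * wt p u v x = 0
  · have hG0 := ae_zero_of_wt hp' hwm hG hwp hY0
    have h1 := hyp u v (hu.mono hKK) (hv.mono hKK)
    rw [zero_of_ae_zero hp0' hG0, mul_zero, nonpos_iff_eq_zero] at h1
    have hF0 := ae_zero_of_wt hp0' (wt_meas hu.meas hv.meas) hF (wt_pos hu hv) h1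
    rw [zero_of_ae_zero hp' hF0]
    exact zero_le
  let T : ℕ → ℝ → ℝ≥0∞ := fun N => (qI (-(N : ℚ), (N : ℚ))).indicator (fun x => min (F x) N)
  have hTm : ∀ N, Measurable (T N) := fun N =>
    (hF.min measurable_const).indicator (qI_meas _)
  have hTF : ∀ N x, T N x ≤ F x := by
    intro N x
    refine indicator_le' (fun _ _ => min_le_left _ _) (fun _ _ => zero_le) x
  have hTmono : Monotone T := by
    intro a b hab x
    have hab' : (a : ℝ) ≤ b := by exact_mod_cast hab
    have hab'' : (a : ℝ≥0∞) ≤ b := by exact_mod_cast hab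
    have hsub : qI (-(a : ℚ), (a : ℚ)) ⊆ qI (-(b : ℚ), (b : ℚ)) := by
      simp only [qI]
      push_cast
      exact Ioo_subset_Ioo (by linarith) hab'
    simp only [T]
    by_cases hx : x ∈ qI (-(a : ℚ), (a : ℚ))
    · rw [indicator_of_mem hx, indicator_of_mem (hsub hx)]
      exact min_le_min le_rfl hab''
    · rw [indicator_of_notMem hx]
      exact zero_le
  have hTsup : ∀ x, F x = ⨆ N, T N x := by
    intro x
    refine le_antisymm ?_ (iSup_le fun N => hTF N x)
    obtain ⟨n0, hn0⟩ := exists_nat_gt |x|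
    refine le_of_forall_lt fun c hc => ?_
    obtain ⟨m, hm⟩ := ENNReal.exists_nat_gt hc.ne_top
    refine lt_of_lt_of_le ?_ (le_iSup (fun N => T N x) (n0 + m))
    have hx : x ∈ qI (-((n0 + m : ℕ) : ℚ), ((n0 + m : ℕ) : ℚ)) := by
      have h1 : |x| < ((n0 + m : ℕ) : ℝ) := by
        push_cast
        have : (0:ℝ) ≤ m := m.cast_nonneg
        linarith
      have := abs_lt.1 h1
      simpa [qI] using this
    simp only [T]
    rw [indicator_of_mem hx]
    refine lt_min hc (hm.trans_le ?_)
    push_cast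
    exact le_add_self
  have hTt : ∀ N, ∫⁻ x, T N x ^ p * wt p u v x ≠ ⊤ := by
    intro N
    rcases Nat.eq_zero_or_pos N with rfl | hN
    · have : ∀ x, T 0 x = 0 := by
        intro x; simp [T, qI]
      simp [this, hp']
    have hI0 : volume (qI (-(N : ℚ), (N : ℚ))) ≠ 0 := by
      simp [qI]; exact hN.ne'
    have hle : ∫⁻ x, T N x ^ p * wt p u v x ≤
        (N : ℝ≥0∞) ^ p * ∫⁻ x in qI (-(N : ℚ), (N : ℚ)), wt p u v x := by
      rw [← lintegral_indicator (qI_meas _),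
        ← lintegral_const_mul _ (hwm.indicator (qI_meas _))]
      refine lintegral_mono fun x => ?_
      simp only [T]
      by_cases hx : x ∈ qI (-(N : ℚ), (N : ℚ))
      · rw [indicator_of_mem hx, indicator_of_mem hx]
        gcongr
        exact min_le_right _ _
      · rw [indicator_of_notMem hx, ENNReal.zero_rpow_of_pos hp', zero_mul]
        exact zero_le
    refine ne_top_of_le_ne_top (ENNReal.mul_ne_top ?_ (wt_int_ne_top hK0 hK hu hv hp _ hI0)) hle
    exact ENNReal.rpow_ne_top_of_nonneg hp'.le (by simp)
  have hfin : ∀ N, ∫⁻ x, T N x ^ p * wt p u v x ≤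
      ((C0 ^ (1 / p0) * 4) ^ p + 1) * ∫⁻ x, G x ^ p * wt p u v x := by
    intro N
    refine (R C0 (T N) G (hTm N) hG (fun u' v' hu' hv' => ?_) u v hu hv (hTt N) hY hY0).trans ?_
    · refine le_trans (lintegral_mono fun x => ?_) (hyp u' v' hu' hv')
      gcongr
      exact hTF N x
    · gcongr
      exact le_self_add
  have hs : ∀ x, F x ^ p * wt p u v x = ⨆ N, T N x ^ p * wt p u v x := by
    intro x
    rw [hTsup x, rpow_iSup' _ hp', ENNReal.iSup_mul]
  simp_rw [hs]
  have hm : ∀ N, Measurable (fun x => T N x ^ p * wt p u v x) :=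
    fun N => ((hTm N).pow_const p).mul hwm
  rw [lintegral_iSup hm]
  · exact iSup_le hfin
  · intro a b hab x
    exact mul_le_mul' (ENNReal.rpow_le_rpow (hTmono hab x) hp'.le) le_rfl

lemma snoc_meas (m : ℕ) :
    Measurable (fun z : (Fin m → ℝ) × ℝ => (Fin.snoc z.1 z.2 : Fin (m + 1) → ℝ)) := by
  refine measurable_pi_iff.2 fun i => ?_
  refine Fin.lastCases ?_ (fun j => ?_) i
  · simp only [Fin.snoc_last]; exact measurable_snd
  · simp only [Fin.snoc_castSucc]; exact (measurable_pi_apply j).comp measurable_fst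

lemma mixedLnorm_mono (m : ℕ) : ∀ (q : Fin m → ℝ), (∀ j, 0 < q j) →
    ∀ g h : (Fin m → ℝ) → ℝ≥0∞, (∀ x, g x ≤ h x) → mixedLnorm m q g ≤ mixedLnorm m q h := by
  induction m with
  | zero => intro q hq g h hgh; exact hgh _
  | succ m ih =>
    intro q hq g h hgh
    simp only [mixedLnorm]
    have h1 := hq (Fin.last m)
    refine ENNReal.rpow_le_rpow (lintegral_mono fun t => ENNReal.rpow_le_rpow ?_ h1.le)
      (by positivity)
    exact ih _ (fun j => hq _) _ _ fun x => hgh _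

lemma mixedLnorm_const_mul (m : ℕ) : ∀ (q : Fin m → ℝ), (∀ j, 0 < q j) →
    ∀ (c : ℝ≥0∞), c ≠ ⊤ → ∀ g : (Fin m → ℝ) → ℝ≥0∞,
      mixedLnorm m q (fun x => c * g x) = c * mixedLnorm m q g := by
  induction m with
  | zero => intro q hq c hc g; rfl
  | succ m ih =>
    intro q hq c hc g
    simp only [mixedLnorm]
    have h1 := hq (Fin.last m)
    have h2 : ∀ t : ℝ, mixedLnorm m (fun i => q i.castSucc) (fun y => c * g (Fin.snoc y t)) =
        c * mixedLnorm m (fun i => q i.castSucc) (fun y => g (Fin.snoc y t)) :=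
      fun t => ih _ (fun j => hq _) c hc _
    simp only [h2, ENNReal.mul_rpow_of_nonneg _ _ h1.le]
    rw [lintegral_const_mul' _ _ (ENNReal.rpow_ne_top_of_nonneg h1.le hc),
      ENNReal.mul_rpow_of_nonneg _ _ (by positivity), ← ENNReal.rpow_mul,
      mul_one_div_cancel h1.ne', ENNReal.rpow_one]

lemma mixedLnorm_meas (m : ℕ) : ∀ (q : Fin m → ℝ) {α : Type} [MeasurableSpace α]
    (h : α → (Fin m → ℝ) → ℝ≥0∞), Measurable (fun z : α × (Fin m → ℝ) => h z.1 z.2) →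
    Measurable (fun a => mixedLnorm m q (h a)) := by
  induction m with
  | zero =>
    intro q α _ h hh
    simp only [mixedLnorm]
    exact hh.comp (measurable_id.prodMk measurable_const)
  | succ m ih =>
    intro q α _ h hh
    simp only [mixedLnorm]
    refine Measurable.pow_const ?_ _
    have h1 := ih (fun i => q i.castSucc) (α := α × ℝ)
      (fun z y => h z.1 (Fin.snoc y z.2)) ?_
    · exact Measurable.lintegral_prod_right' (f := fun z : α × ℝ =>
        mixedLnorm m (fun i => q i.castSucc) (fun y => h z.1 (Fin.snoc y z.2)) ^ q (Fin.last m))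
        (h1.pow_const _)
    · have h2 : Measurable (fun z : (α × ℝ) × (Fin m → ℝ) =>
          (z.1.1, (Fin.snoc z.2 z.1.2 : Fin (m + 1) → ℝ))) :=
        (measurable_fst.comp measurable_fst).prodMk
          ((snoc_meas m).comp (measurable_snd.prodMk (measurable_snd.comp measurable_fst)))
      exact hh.comp h2

lemma Mmax_joint {β : Type} [MeasurableSpace β] (g : β → ℝ → ℝ≥0∞)
    (hg : Measurable (fun z : β × ℝ => g z.1 z.2)) :
    Measurable (fun z : β × ℝ => Mmax volume (g z.1) z.2) := by
  unfold Mmax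
  refine Measurable.iSup fun i => ?_
  have h1 : Measurable (fun b : β => (volume (qI i))⁻¹ * ∫⁻ y in qI i, g b y) :=
    (Measurable.lintegral_prod_right' hg).const_mul _
  have h2 : (fun z : β × ℝ => (qI i).indicator
      (fun _ => (volume (qI i))⁻¹ * ∫⁻ y in qI i, g z.1 y) z.2) =
      (Prod.snd ⁻¹' (qI i)).indicator
        (fun z : β × ℝ => (volume (qI i))⁻¹ * ∫⁻ y in qI i, g z.1 y) := by
    ext z
    rfl
  rw [h2]
  exact (h1.comp measurable_fst).indicator (measurable_snd (qI_meas i))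

/-- Vector-valued weighted maximal inequality. -/
lemma vecval (m : ℕ) : ∀ (q : Fin m → ℝ), (∀ j, 1 < q j) → ∀ p : ℝ, 1 < p → ∀ K : ℝ≥0∞,
    K ≠ 0 → K ≠ ⊤ → ∃ C : ℝ≥0∞, C ≠ ⊤ ∧ ∀ g : (Fin m → ℝ) → ℝ → ℝ≥0∞,
      Measurable (fun z : (Fin m → ℝ) × ℝ => g z.1 z.2) → ∀ u v, A1 K u → A1 K v →
      ∫⁻ t, mixedLnorm m q (fun y => Mmax volume (g y) t) ^ p * wt p u v t ≤
        C * ∫⁻ t, mixedLnorm m q (fun y => g y t) ^ p * wt p u v t := by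
  induction m with
  | zero =>
    intro q hq p hp K hK0 hK
    obtain ⟨C, hC, H⟩ := muck (Real.HolderConjugate.conjExponent hp) hK0 hK
    refine ⟨C, hC, fun g hg u v hu hv => ?_⟩
    exact H u v hu hv _ (hg.comp (measurable_const.prodMk measurable_id))
  | succ m ih =>
    intro q hq p hp K hK0 hK
    have hp0 := hq (Fin.last m)
    have hp0' : 0 < q (Fin.last m) := by linarith
    obtain ⟨K', hK0', hK', R⟩ := extrap hp hp0 hK0 hK
    obtain ⟨C0, hC0, H⟩ := ih (fun i => q i.castSucc) (fun j => hq _) _ hp0 K' hK0' hK'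
    obtain ⟨C, hC, R⟩ := R C0 hC0
    refine ⟨C, hC, fun g hg u v hu hv => ?_⟩
    have hMg := Mmax_joint g hg
    have swap : ∀ h : (Fin (m + 1) → ℝ) → ℝ → ℝ≥0∞,
        Measurable (fun z : (Fin (m + 1) → ℝ) × ℝ => h z.1 z.2) →
        Measurable (fun z : ℝ × (Fin (m + 1) → ℝ) => h z.2 z.1) :=
      fun h hh => hh.comp measurable_swap
    refine R _ _ (mixedLnorm_meas (m + 1) q (fun t y => Mmax volume (g y) t) (swap (fun y t => Mmax volume (g y) t) hMg))
      (mixedLnorm_meas (m + 1) q (fun t y => g y t) (swap g hg)) ?_ u v hu hv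
    intro u v hu hv
    have hwm : Measurable (wt (q (Fin.last m)) u v) := wt_meas hu.meas hv.meas
    have key : ∀ h : (Fin (m + 1) → ℝ) → ℝ → ℝ≥0∞,
        Measurable (fun z : (Fin (m + 1) → ℝ) × ℝ => h z.1 z.2) →
        ∫⁻ t, mixedLnorm (m + 1) q (fun y => h y t) ^ q (Fin.last m) * wt (q (Fin.last m)) u v t =
        ∫⁻ s, ∫⁻ t, mixedLnorm m (fun i => q i.castSucc)
          (fun y => h (Fin.snoc y s) t) ^ q (Fin.last m) * wt (q (Fin.last m)) u v t := by
      intro h hh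
      have hm : Measurable (fun z : ℝ × ℝ => mixedLnorm m (fun i => q i.castSucc)
          (fun y => h (Fin.snoc y z.2) z.1)) := by
        refine mixedLnorm_meas m _ (fun (z : ℝ × ℝ) y => h (Fin.snoc y z.2) z.1) ?_
        have h2 : Measurable (fun z : (ℝ × ℝ) × (Fin m → ℝ) =>
            ((Fin.snoc z.2 z.1.2 : Fin (m + 1) → ℝ), z.1.1)) :=
          ((snoc_meas m).comp (measurable_snd.prodMk (measurable_snd.comp measurable_fst))).prodMk
            (measurable_fst.comp measurable_fst)
        exact hh.comp h2
      rw [lintegral_lintegral_swap]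
      · refine lintegral_congr fun t => ?_
        simp only [mixedLnorm]
        rw [← ENNReal.rpow_mul, one_div_mul_cancel hp0'.ne', ENNReal.rpow_one,
          lintegral_mul_const]
        exact (hm.comp (measurable_const.prodMk measurable_id)).pow_const _
      · have : Measurable (fun z : ℝ × ℝ => mixedLnorm m (fun i => q i.castSucc)
          (fun y => h (Fin.snoc y z.1) z.2) ^ q (Fin.last m) * wt (q (Fin.last m)) u v z.2) :=
          ((hm.comp measurable_swap).pow_const _).mul (hwm.comp measurable_snd)
        exact this.aemeasurable
    rw [key _ hMg, key _ hg, ← lintegral_const_mul' _ _ hC0]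
    refine lintegral_mono fun s => ?_
    refine H (fun y => g (Fin.snoc y s)) ?_ u v hu hv
    have h2 : Measurable (fun z : (Fin m → ℝ) × ℝ =>
        ((Fin.snoc z.1 s : Fin (m + 1) → ℝ), z.2)) :=
      ((snoc_meas m).comp (measurable_fst.prodMk measurable_const)).prodMk measurable_snd
    exact hg.comp h2

/-- Iterated one-dimensional maximal operator. -/
def Nop : (n : ℕ) → ((Fin n → ℝ) → ℝ≥0∞) → (Fin n → ℝ) → ℝ≥0∞
  | 0, g => g
  | (n + 1), g => fun x =>
      Nop n (fun y => Mmax volume (fun s => g (Fin.snoc y s)) (x (Fin.last n))) (Fin.init x)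

lemma A1_one : A1 1 (fun _ => 1) := by
  refine ⟨measurable_const, by simp, by simp, ?_⟩
  refine Filter.Eventually.of_forall fun x => Mmax_le fun i hi => ?_
  simp only [lintegral_const, one_mul, Measure.restrict_apply, MeasurableSet.univ, univ_inter, mul_one]
  exact ENNReal.inv_mul_le_one _

lemma Nop_bound (n : ℕ) : ∀ (q : Fin n → ℝ), (∀ j, 1 < q j) →
    ∃ C : ℝ≥0∞, C ≠ ⊤ ∧ ∀ g : (Fin n → ℝ) → ℝ≥0∞, Measurable g →
      mixedLnorm n q (Nop n g) ≤ C * mixedLnorm n q g := by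
  induction n with
  | zero => intro q hq; exact ⟨1, by simp, fun g hg => by simp [Nop]⟩
  | succ n ih =>
    intro q hq
    have hp := hq (Fin.last n)
    have hp' : 0 < q (Fin.last n) := by linarith
    obtain ⟨C1, hC1, H1⟩ := ih (fun i => q i.castSucc) (fun j => hq _)
    obtain ⟨C2, hC2, H2⟩ := vecval n (fun i => q i.castSucc) (fun j => hq _) _ hp 1
      one_ne_zero ENNReal.one_ne_top
    refine ⟨C1 * C2 ^ (1 / q (Fin.last n)), ENNReal.mul_ne_top hC1
      (ENNReal.rpow_ne_top_of_nonneg (by positivity) hC2), fun g hg => ?_⟩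
    have hgs : Measurable (fun z : (Fin n → ℝ) × ℝ => g (Fin.snoc z.1 z.2)) :=
      hg.comp (snoc_meas n)
    have hMg := Mmax_joint (fun y s => g (Fin.snoc y s)) hgs
    have h3 := H2 (fun y s => g (Fin.snoc y s)) hgs _ _ A1_one A1_one
    simp only [wt, ENNReal.one_rpow, mul_one] at h3
    simp only [mixedLnorm, Nop, Fin.snoc_last, Fin.init_snoc]
    calc _ ≤ (∫⁻ t, (C1 * mixedLnorm n (fun i => q i.castSucc)
            (fun y => Mmax volume (fun s => g (Fin.snoc y s)) t)) ^ q (Fin.last n)) ^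
            (1 / q (Fin.last n)) := by
          refine ENNReal.rpow_le_rpow (lintegral_mono fun t => ENNReal.rpow_le_rpow ?_ hp'.le)
            (by positivity)
          exact H1 _ (hMg.comp (measurable_id.prodMk measurable_const))
      _ = C1 * (∫⁻ t, (mixedLnorm n (fun i => q i.castSucc)
            (fun y => Mmax volume (fun s => g (Fin.snoc y s)) t)) ^ q (Fin.last n)) ^
            (1 / q (Fin.last n)) := by
          simp only [ENNReal.mul_rpow_of_nonneg _ _ hp'.le]
          rw [lintegral_const_mul' _ _ (ENNReal.rpow_ne_top_of_nonneg hp'.le hC1),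
            ENNReal.mul_rpow_of_nonneg _ _ (by positivity), ← ENNReal.rpow_mul,
            mul_one_div_cancel hp'.ne', ENNReal.rpow_one]
      _ ≤ C1 * (C2 * ∫⁻ t, (mixedLnorm n (fun i => q i.castSucc)
            (fun y => g (Fin.snoc y t))) ^ q (Fin.last n)) ^
            (1 / q (Fin.last n)) :=
          mul_le_mul' le_rfl (ENNReal.rpow_le_rpow h3 (by positivity))
      _ = _ := by
          rw [ENNReal.mul_rpow_of_nonneg _ _ (by positivity), mul_assoc]

lemma Mmax_interval (f : ℝ → ℝ≥0∞) (x r : ℝ) (hr : 0 < r) :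
    ∫⁻ s in Ioo (x - r) (x + r), f s ≤ ENNReal.ofReal (4 * r) * Mmax volume f x := by
  obtain ⟨a, ha1, ha2⟩ := exists_rat_btwn (show x - 2 * r < x - r by linarith)
  obtain ⟨b, hb1, hb2⟩ := exists_rat_btwn (show x + r < x + 2 * r by linarith)
  have hx : x ∈ qI (a, b) := ⟨by simp only; linarith, by simp only; linarith⟩
  have hvol : volume (qI (a, b)) = ENNReal.ofReal (b - a) := by simp [qI]
  have h0 : volume (qI (a, b)) ≠ 0 := by
    rw [hvol]; simp only [ne_eq, ENNReal.ofReal_eq_zero, not_le]; linarith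
  calc _ ≤ ∫⁻ s in qI (a, b), f s :=
        lintegral_mono_set (Ioo_subset_Ioo ha2.le hb1.le)
    _ = volume (qI (a, b)) * ((volume (qI (a, b)))⁻¹ * ∫⁻ s in qI (a, b), f s) := by
        rw [← mul_assoc, ENNReal.mul_inv_cancel h0 (vol_qI_ne_top _), one_mul]
    _ ≤ _ := by
        refine mul_le_mul' ?_ (le_Mmax volume f _ hx)
        rw [hvol]
        exact ENNReal.ofReal_le_ofReal (by linarith)

/-- Cubes. -/
def cube (n : ℕ) (x : Fin n → ℝ) (r : ℝ) : Set (Fin n → ℝ) :=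
  Set.pi univ (fun i => Ioo (x i - r) (x i + r))

lemma cube_meas (n : ℕ) (x : Fin n → ℝ) (r : ℝ) : MeasurableSet (cube n x r) :=
  MeasurableSet.univ_pi fun _ => measurableSet_Ioo

lemma cube_snoc (n : ℕ) (x : Fin (n + 1) → ℝ) (r : ℝ) (y : Fin n → ℝ) (s : ℝ) :
    (Fin.snoc y s : Fin (n + 1) → ℝ) ∈ cube (n + 1) x r ↔
      y ∈ cube n (Fin.init x) r ∧ s ∈ Ioo (x (Fin.last n) - r) (x (Fin.last n) + r) := by
  simp only [cube, mem_univ_pi, Fin.forall_fin_succ', Fin.snoc_castSucc, Fin.snoc_last, Fin.init]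

lemma lintegral_snoc (n : ℕ) (h : (Fin (n + 1) → ℝ) → ℝ≥0∞) (hh : Measurable h) :
    ∫⁻ x, h x = ∫⁻ y : Fin n → ℝ, ∫⁻ s : ℝ, h (Fin.snoc y s) := by
  have e := (volume_preserving_piFinSuccAbove (fun _ : Fin (n + 1) => ℝ) (Fin.last n)).symm
  rw [← e.lintegral_comp hh]
  have : ∀ z : ℝ × (Fin n → ℝ), (MeasurableEquiv.piFinSuccAbove (fun _ : Fin (n + 1) => ℝ)
      (Fin.last n)).symm z = Fin.snoc z.2 z.1 := by
    intro z
    exact Fin.insertNth_last' z.1 z.2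
  simp only [this]
  rw [Measure.volume_eq_prod, lintegral_prod_symm']
  exact hh.comp ((snoc_meas n).comp measurable_swap)

lemma cube_le (n : ℕ) : ∀ (x : Fin n → ℝ) (r : ℝ), 0 < r → ∀ g : (Fin n → ℝ) → ℝ≥0∞,
    Measurable g → ∫⁻ y in cube n x r, g y ≤ ENNReal.ofReal (4 * r) ^ n * Nop n g x := by
  induction n with
  | zero =>
    intro x r hr g hg
    have h1 : ∀ y, g y = g x := fun y => by rw [Subsingleton.elim y x]
    have h2 : cube 0 x r = univ := eq_univ_of_forall fun y i => i.elim0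
    have h3 : volume (univ : Set (Fin 0 → ℝ)) = 1 := by
      rw [volume_pi, Measure.pi_univ]; simp
    simp only [h1, h2, Nop]
    simp [h3]
  | succ n ih =>
    intro x r hr g hg
    have hgs : Measurable (fun z : (Fin n → ℝ) × ℝ => g (Fin.snoc z.1 z.2)) :=
      hg.comp (snoc_meas n)
    have hMg := Mmax_joint (fun y s => g (Fin.snoc y s)) hgs
    rw [← lintegral_indicator (cube_meas _ _ _), lintegral_snoc n _ (hg.indicator (cube_meas _ _ _))]
    calc _ = ∫⁻ y in cube n (Fin.init x) r,
          ∫⁻ s in Ioo (x (Fin.last n) - r) (x (Fin.last n) + r), g (Fin.snoc y s) := by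
          rw [← lintegral_indicator (cube_meas _ _ _)]
          refine lintegral_congr fun y => ?_
          by_cases hy : y ∈ cube n (Fin.init x) r
          · rw [indicator_of_mem hy, ← lintegral_indicator measurableSet_Ioo]
            refine lintegral_congr fun s => ?_
            simp only [indicator, cube_snoc, hy, true_and]
          · rw [indicator_of_notMem hy]
            simp [indicator, cube_snoc, hy]
      _ ≤ ∫⁻ y in cube n (Fin.init x) r, ENNReal.ofReal (4 * r) *
          Mmax volume (fun s => g (Fin.snoc y s)) (x (Fin.last n)) :=
          lintegral_mono fun y => Mmax_interval _ _ _ hr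
      _ = ENNReal.ofReal (4 * r) * ∫⁻ y in cube n (Fin.init x) r,
          Mmax volume (fun s => g (Fin.snoc y s)) (x (Fin.last n)) :=
          lintegral_const_mul' _ _ ENNReal.ofReal_ne_top
      _ ≤ ENNReal.ofReal (4 * r) * (ENNReal.ofReal (4 * r) ^ n * Nop n (fun y =>
          Mmax volume (fun s => g (Fin.snoc y s)) (x (Fin.last n))) (Fin.init x)) :=
          mul_le_mul' le_rfl (ih _ _ hr _ (hMg.comp (measurable_id.prodMk measurable_const)))
      _ = _ := by rw [← mul_assoc, ← pow_succ', Nop]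

lemma hlMax_le (n : ℕ) (hn : 0 < n) (f : (Fin n → ℝ) → ℝ) (hf : Measurable f) (x : Fin n → ℝ) :
    hlMax n f x ≤ ENNReal.ofReal (2 * n) ^ n * Nop n (fun y => ENNReal.ofReal |f y|) x := by
  have hn' : (0 : ℝ) < n := by exact_mod_cast hn
  have hn1 : (1 : ℝ) ≤ n := by exact_mod_cast hn
  unfold hlMax
  refine iSup_le fun r => iSup_le fun hr => ?_
  have hg : Measurable (fun y => ENNReal.ofReal |f y|) :=
    (continuous_abs.measurable.comp hf).ennreal_ofReal
  have hsub : eball n x r ⊆ cube n x r := by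
    intro y hy i _
    have h1 : (x i - y i) ^ 2 ≤ ∑ j, (x j - y j) ^ 2 :=
      Finset.single_le_sum (f := fun j => (x j - y j) ^ 2) (fun j _ => sq_nonneg _)
        (Finset.mem_univ i)
    have h2 : |x i - y i| < r := lt_of_le_of_lt (Real.abs_le_sqrt h1) hy
    rw [abs_lt] at h2
    exact ⟨by linarith, by linarith⟩
  have hsup : cube n x (r / n) ⊆ eball n x r := by
    intro y hy
    have hrn : 0 < r / n := by positivity
    have h1 : ∀ j ∈ Finset.univ, (x j - y j) ^ 2 < (r / n) ^ 2 := by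
      intro j _
      have := hy j (mem_univ j)
      simp only [mem_Ioo] at this
      exact sq_lt_sq' (by linarith) (by linarith)
    have h2 : ∑ j, (x j - y j) ^ 2 < ∑ j : Fin n, (r / n) ^ 2 :=
      Finset.sum_lt_sum_of_nonempty ⟨⟨0, hn⟩, Finset.mem_univ _⟩ h1
    have h3 : ∑ j : Fin n, (r / n) ^ 2 ≤ r ^ 2 := by
      simp only [Finset.sum_const, Finset.card_univ, Fintype.card_fin, nsmul_eq_mul]
      rw [div_pow, mul_div_assoc', div_le_iff₀ (by positivity), mul_comm]
      have : (n : ℝ) ≤ n ^ 2 := by nlinarith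
      nlinarith [sq_nonneg r]
    change Real.sqrt _ < r
    rw [Real.sqrt_lt' hr]
    linarith
  have hvol : volume (cube n x (r / n)) = ENNReal.ofReal (2 * r / n) ^ n := by
    unfold cube
    rw [Real.volume_pi_Ioo]
    have : ∀ i, x i + r / n - (x i - r / n) = 2 * r / n := fun i => by ring
    simp [this]
  have hd0 : ENNReal.ofReal (2 * r / n) ^ n ≠ 0 := by
    apply pow_ne_zero
    simp only [ne_eq, ENNReal.ofReal_eq_zero, not_le]
    positivity
  have hdt : ENNReal.ofReal (2 * r / n) ^ n ≠ ⊤ := by finiteness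
  calc _ ≤ (ENNReal.ofReal (2 * r / n) ^ n)⁻¹ * (ENNReal.ofReal (4 * r) ^ n *
        Nop n (fun y => ENNReal.ofReal |f y|) x) := by
        refine mul_le_mul' ?_ ?_
        · rw [ENNReal.inv_le_inv, ← hvol]
          exact measure_mono hsup
        · exact (lintegral_mono_set hsub).trans (cube_le n x r hr _ hg)
    _ = _ := by
        have : 4 * r = 2 * r / n * (2 * n) := by field_simp; ring
        rw [this, ENNReal.ofReal_mul (by positivity), mul_pow, mul_assoc, ← mul_assoc,
          ENNReal.inv_mul_cancel hd0 hdt, one_mul]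

theorem stmt9 (n : ℕ) (hn : 0 < n) (q : Fin n → ℝ) (hq : ∀ j, 1 < q j) :
    ∃ C : ℝ, 0 < C ∧ ∀ f : (Fin n → ℝ) → ℝ, Measurable f → mixedNorm n q f ≠ ⊤ →
      mixedLnorm n q (hlMax n f) ≤ ENNReal.ofReal C * mixedNorm n q f := by
  have hq0 : ∀ j, 0 < q j := fun j => by linarith [hq j]
  obtain ⟨C, hC, H⟩ := Nop_bound n q hq
  have hD : ENNReal.ofReal (2 * n) ^ n * C ≠ ⊤ := ENNReal.mul_ne_top (by finiteness) hC
  refine ⟨(ENNReal.ofReal (2 * n) ^ n * C).toReal + 1,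
    by linarith [ENNReal.toReal_nonneg (a := ENNReal.ofReal (2 * n) ^ n * C)], ?_⟩
  intro f hf _
  have hg : Measurable (fun y => ENNReal.ofReal |f y|) :=
    (continuous_abs.measurable.comp hf).ennreal_ofReal
  calc mixedLnorm n q (hlMax n f)
      ≤ mixedLnorm n q (fun x => ENNReal.ofReal (2 * n) ^ n *
          Nop n (fun y => ENNReal.ofReal |f y|) x) :=
        mixedLnorm_mono n q hq0 _ _ fun x => hlMax_le n hn f hf x
    _ = ENNReal.ofReal (2 * n) ^ n * mixedLnorm n q (Nop n (fun y => ENNReal.ofReal |f y|)) :=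
        mixedLnorm_const_mul n q hq0 _ (by finiteness) _
    _ ≤ ENNReal.ofReal (2 * n) ^ n * (C * mixedLnorm n q (fun y => ENNReal.ofReal |f y|)) :=
        mul_le_mul' le_rfl (H _ hg)
    _ = ENNReal.ofReal (2 * n) ^ n * C * mixedNorm n q f := by rw [mul_assoc]; rfl
    _ ≤ _ := by
        refine mul_le_mul' ?_ le_rfl
        rw [← ENNReal.ofReal_toReal hD]
        refine ENNReal.ofReal_le_ofReal ?_
        rw [ENNReal.ofReal_toReal hD]
        linarith
end
end
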